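/- arXiv:1612.00958 — 4 statements merged into one kernel-verified Lean document; each statement's English description precedes it below -/
import Mathlib

section
/- Let G be a connected graph on n vertices and let T1 = (B1, l1) and T2 = (B2, l2) be two labelled spanning trees of G. Then T1 can be reconfigured to T2 by a sequence of basis exchange steps if and only if for every label i ∈ {1, ..., n−1}, the edge l1⁻¹(i) and the edge l2⁻¹(i) lie in the same 2-connected component of G. -/
open Set Function

universe u

/-- `StepsIn step n a b` means that `b` can be obtained from `a` by exactly `n` steps. -/
def StepsIn {X : Type*} (step : X → X → Prop) : ℕ → X → X → Prop
  | 0, a, b => a = b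
  | n + 1, a, b => ∃ c, step a c ∧ StepsIn step n c b

variable {V : Type u}

/-- `B` is the edge set of a spanning tree of `G`. -/
def IsSpanningTreeOf (G : SimpleGraph V) (B : Set (Sym2 V)) : Prop :=
  B ⊆ G.edgeSet ∧ (SimpleGraph.fromEdgeSet B).IsTree

/-- A labelled spanning tree of a graph `G` on `n` vertices, encoded as the injective map
sending each label `i ∈ {1, …, n-1}` to the edge carrying that label; its range must be
the edge set of a spanning tree of `G`. -/
def IsLabelledSpanningTree [Fintype V] (G : SimpleGraph V)
    (b : Fin (Fintype.card V - 1) → Sym2 V) : Prop :=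
  Function.Injective b ∧ IsSpanningTreeOf G (Set.range b)

/-- One basis exchange step between labelled spanning trees: the edge carrying label `i`
is replaced by an edge `f` of `G` not in the current tree, `f` receives label `i`, and the
result is again a spanning tree.  All other labels are unchanged. -/
def TreeStep [Fintype V] (G : SimpleGraph V)
    (b b' : Fin (Fintype.card V - 1) → Sym2 V) : Prop :=
  ∃ (i : Fin (Fintype.card V - 1)) (f : Sym2 V), f ∈ G.edgeSet ∧ f ∉ Set.range b ∧
    IsSpanningTreeOf G (Set.range (Function.update b i f)) ∧ b' = Function.update b i f

/-- Two edges of `G` lie in the same 2-connected component: they are equal or some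
cycle of `G` contains both of them. -/
def SameBlock (G : SimpleGraph V) (e f : Sym2 V) : Prop :=
  e = f ∨ ∃ (v : V) (w : G.Walk v v), w.IsCycle ∧ e ∈ w.edges ∧ f ∈ w.edges

namespace Matroid

variable {α ι : Type*}

/-- Two elements of a matroid lie in the same connected component: they are equal or some circuit
contains both of them. -/
def SameComponent (M : Matroid α) (x y : α) : Prop :=
  x = y ∨ ∃ C, M.IsCircuit C ∧ x ∈ C ∧ y ∈ C

/-- An injective family whose range is a base. -/
def IsLabelledBase (M : Matroid α) (b : ι → α) : Prop :=
  Injective b ∧ M.IsBase (range b)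

/-- Two labelled bases differ by replacing one element, the new element inheriting the label. -/
def LabelledExchange [DecidableEq ι] (M : Matroid α) (b b' : ι → α) : Prop :=
  M.IsLabelledBase b ∧ M.IsLabelledBase b' ∧ ∃ i, ∃ f ∉ range b, b' = update b i f

theorem _root_.Function.Injective.range_update [DecidableEq ι] {b : ι → α} (hb : Injective b)
    (i : ι) (f : α) : range (update b i f) = insert f (range b \ {b i}) := by
  ext x
  simp only [mem_range, mem_insert_iff, mem_sdiff, mem_singleton_iff]
  constructor
  · rintro ⟨k, rfl⟩
    by_cases hk : k = i
    · subst hk; simp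
    · right
      simp [hk, hb.eq_iff]
  · rintro (rfl | ⟨⟨k, rfl⟩, hk⟩)
    · exact ⟨i, by simp⟩
    · exact ⟨k, by rw [update_of_ne (fun h ↦ hk (by rw [h]))]⟩

theorem _root_.Function.Injective.update_of_notMem_range [DecidableEq ι] {b : ι → α}
    (hb : Injective b) (i : ι) {f : α} (hf : f ∉ range b) : Injective (update b i f) := by
  intro k l hkl
  have h : ∀ k, b k ≠ f := fun k hk ↦ hf ⟨k, hk⟩
  by_cases hk : k = i <;> by_cases hl : l = i
  · rw [hk, hl]
  · subst hk
    simp only [update_self, update_of_ne hl] at hkl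
    exact absurd hkl.symm (h l)
  · subst hl
    simp only [update_self, update_of_ne hk] at hkl
    exact absurd hkl (h k)
  · simp only [update_of_ne hk, update_of_ne hl] at hkl
    exact hb hkl

theorem IsLabelledBase.comp_equiv {M : Matroid α} {b : ι → α}
    (hb : M.IsLabelledBase b) (σ : Equiv.Perm ι) : M.IsLabelledBase (b ∘ σ) :=
  ⟨hb.1.comp σ.injective, by rw [σ.surjective.range_comp]; exact hb.2⟩

variable [DecidableEq ι] {M : Matroid α} {b b' : ι → α} {C I : Set α} {x y z : α} {i j : ι}

theorem LabelledExchange.symm (h : M.LabelledExchange b b') : M.LabelledExchange b' b := by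
  obtain ⟨hb, hb', i, f, hf, rfl⟩ := h
  refine ⟨hb', hb, i, b i, ?_, by ext; simp⟩
  rw [hb.1.range_update]
  simp only [mem_insert_iff, mem_sdiff, mem_singleton_iff, not_true, and_false, or_false]
  exact fun h ↦ hf ⟨i, h⟩

theorem LabelledExchange.comp_equiv (h : M.LabelledExchange b b') (σ : Equiv.Perm ι) :
    M.LabelledExchange (b ∘ σ) (b' ∘ σ) := by
  obtain ⟨hb, hb', i, f, hf, rfl⟩ := h
  refine ⟨hb.comp_equiv σ, hb'.comp_equiv σ, σ.symm i, f, ?_, ?_⟩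
  · rwa [σ.surjective.range_comp]
  · rw [update_comp_equiv]

theorem LabelledExchange.sameComponent (h : M.LabelledExchange b b') (k : ι) :
    M.SameComponent (b k) (b' k) := by
  obtain ⟨hb, hb', i, f, hf, rfl⟩ := h
  by_cases hk : k = i
  · subst hk
    have hfE : f ∈ M.E := hb'.2.subset_ground ⟨k, by simp⟩
    refine .inr ⟨_, hb.2.fundCircuit_isCircuit hfE hf, ?_, ?_⟩
    · rw [hb.2.indep.mem_fundCircuit_iff (by rwa [hb.2.closure_eq]) hf]
      have h := hb'.2.indep
      rw [hb.1.range_update] at h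
      refine h.subset ?_
      grind
    · simpa using M.mem_fundCircuit f (range b)
  · exact .inl (by simp [hk])

theorem IsCircuit.exists_isCircuit_mem_mem [M.Finitary] {C₁ C₂ : Set α}
    (h₁ : M.IsCircuit C₁) (h₂ : M.IsCircuit C₂) (hx : x ∈ C₁) (hz : z ∈ C₂)
    (hne : (C₁ ∩ C₂).Nonempty) : ∃ C, M.IsCircuit C ∧ x ∈ C ∧ z ∈ C := by
  induction hn : (C₁ ∪ C₂).ncard using Nat.strong_induction_on generalizing C₁ C₂ with
  | _ n ih =>
  subst hn
  by_cases hx₂ : x ∈ C₂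
  · exact ⟨C₂, h₂, hx₂, hz⟩
  by_cases hz₁ : z ∈ C₁
  · exact ⟨C₁, h₁, hx, hz₁⟩
  have hfin : (C₁ ∪ C₂).Finite := h₁.finite.union h₂.finite
  obtain ⟨y, hy₁, hy₂⟩ := hne
  obtain ⟨C₃, hC₃s, hC₃, hxC₃⟩ := h₁.strong_elimination h₂ hy₁ hy₂ hx hx₂
  obtain ⟨C₄, hC₄s, hC₄, hzC₄⟩ := h₂.strong_elimination h₁ hy₂ hy₁ hz hz₁
  have key : ∀ D₁ D₂ : Set α, M.IsCircuit D₁ → M.IsCircuit D₂ → x ∈ D₁ → z ∈ D₂ →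
      (D₁ ∩ D₂).Nonempty → D₁ ∪ D₂ ⊂ C₁ ∪ C₂ → ∃ C, M.IsCircuit C ∧ x ∈ C ∧ z ∈ C :=
    fun D₁ D₂ hD₁ hD₂ hxD hzD hne hss ↦ ih _ (ncard_lt_ncard hss hfin) hD₁ hD₂ hxD hzD hne rfl
  obtain ⟨p, hp₃, hp₁⟩ : ∃ p ∈ C₃, p ∉ C₁ := by
    by_contra! h
    exact (hC₃s ((hC₃.eq_of_subset_isCircuit h₁ h).symm ▸ hy₁)).2 rfl
  obtain ⟨q, hq₄, hq₂⟩ : ∃ q ∈ C₄, q ∉ C₂ := by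
    by_contra! h
    exact (hC₄s ((hC₄.eq_of_subset_isCircuit h₂ h).symm ▸ hy₂)).2 rfl
  have hp₂ : p ∈ C₂ := (hC₃s hp₃).1.resolve_left hp₁
  have hq₁ : q ∈ C₁ := (hC₄s hq₄).1.resolve_left hq₂
  have hs₄ : C₄ ⊆ C₁ ∪ C₂ := fun a ha ↦ (hC₄s ha).1.symm
  have hs₃ : C₃ ⊆ C₁ ∪ C₂ := fun a ha ↦ (hC₃s ha).1
  by_cases hp₄ : p ∈ C₄
  · refine key C₃ C₄ hC₃ hC₄ hxC₃ hzC₄ ⟨p, hp₃, hp₄⟩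
      ((ssubset_iff_of_subset (union_subset hs₃ hs₄)).2 ⟨y, .inl hy₁, ?_⟩)
    rintro (h | h)
    · exact (hC₃s h).2 rfl
    · exact (hC₄s h).2 rfl
  · refine key C₁ C₄ h₁ hC₄ hx hzC₄ ⟨q, hq₁, hq₄⟩
      ((ssubset_iff_of_subset (union_subset subset_union_left hs₄)).2 ⟨p, .inr hp₂, ?_⟩)
    rintro (h | h)
    exacts [hp₁ h, hp₄ h]

theorem SameComponent.symm (h : M.SameComponent x y) : M.SameComponent y x := by
  rcases h with rfl | ⟨C, hC, hx, hy⟩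
  · exact .inl rfl
  · exact .inr ⟨C, hC, hy, hx⟩

theorem SameComponent.trans [M.Finitary] (hxy : M.SameComponent x y) (hyz : M.SameComponent y z) :
    M.SameComponent x z := by
  rcases hxy with rfl | ⟨C₁, hC₁, hx, hy₁⟩
  · exact hyz
  rcases hyz with rfl | ⟨C₂, hC₂, hy₂, hz⟩
  · exact .inr ⟨C₁, hC₁, hx, hy₁⟩
  · exact .inr (hC₁.exists_isCircuit_mem_mem hC₂ hx hz ⟨y, hy₁, hy₂⟩)

theorem IsLabelledBase.exchange_update (hb : M.IsLabelledBase b) (hxE : x ∈ M.E)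
    (hx : x ∉ range b) (hi : b i ∈ M.fundCircuit x (range b)) :
    M.LabelledExchange b (update b i x) := by
  refine ⟨hb, ⟨hb.1.update_of_notMem_range i hx, ?_⟩, i, x, hx, rfl⟩
  rw [hb.2.indep.mem_fundCircuit_iff (by rwa [hb.2.closure_eq]) hx] at hi
  rw [hb.1.range_update, insert_sdiff_singleton_comm fun h ↦ hx ⟨i, h.symm⟩]
  exact hb.2.exchange_isBase_of_indep' ⟨i, rfl⟩ hx hi

theorem IsLabelledBase.exchange_update_of_isCircuit (hb : M.IsLabelledBase b)
    (hC : M.IsCircuit C) (hx : x ∈ C) (hCb : C \ {x} ⊆ range b) (hi : b i ∈ C) :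
    M.LabelledExchange b (update b i x) ∧ C \ {b i} ⊆ range (update b i x) := by
  have hCs : C ⊆ insert x (range b) := by
    rwa [← sdiff_singleton_subset_iff]
  have hxb : x ∉ range b := fun h ↦
    hC.not_indep (hb.2.indep.subset (by rwa [insert_eq_of_mem h] at hCs))
  refine ⟨hb.exchange_update (hC.subset_ground hx) hxb ?_, ?_⟩
  · rwa [← hC.eq_fundCircuit_of_subset hb.2.indep hCs]
  · rw [hb.1.range_update]
    grind

open Relation

theorem LabelledExchange.reflTransGen_symm (h : ReflTransGen M.LabelledExchange b b') :
    ReflTransGen M.LabelledExchange b' b :=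
  have : Std.Symm (M.LabelledExchange (ι := ι)) := ⟨fun _ _ h ↦ h.symm⟩
  symm_of _ h

theorem LabelledExchange.reflTransGen_comp_equiv (h : ReflTransGen M.LabelledExchange b b')
    (σ : Equiv.Perm ι) : ReflTransGen M.LabelledExchange (b ∘ σ) (b' ∘ σ) :=
  ReflTransGen.lift (· ∘ σ) (fun _ _ h ↦ h.comp_equiv σ) _ _ h

theorem IsLabelledBase.of_reflTransGen (hb : M.IsLabelledBase b)
    (h : ReflTransGen M.LabelledExchange b b') : M.IsLabelledBase b' := by
  induction h with
  | refl => exact hb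
  | tail _ h _ => exact h.2.1

theorem LabelledExchange.sameComponent_of_reflTransGen [M.Finitary]
    (h : ReflTransGen M.LabelledExchange b b') (k : ι) : M.SameComponent (b k) (b' k) := by
  induction h with
  | refl => exact .inl rfl
  | tail _ h ih => exact ih.trans (h.sameComponent k)

/-- A labelled base can be reconfigured so as to contain a given finite independent set, without
moving the labels of the elements of that set. -/
theorem IsLabelledBase.exists_reflTransGen_subset_range (hb : M.IsLabelledBase b)
    (hI : M.Indep I) (hIfin : I.Finite) :
    ∃ b', ReflTransGen M.LabelledExchange b b' ∧ I ⊆ range b' ∧ ∀ k, b k ∈ I → b' k = b k := by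
  induction hn : (I \ range b).ncard using Nat.strong_induction_on generalizing b with
  | _ n ih =>
  subst hn
  by_cases hIb : I ⊆ range b
  · exact ⟨b, .refl, hIb, fun _ _ ↦ rfl⟩
  obtain ⟨x, hxI, hxb⟩ := not_subset.1 hIb
  have hxE := hI.subset_ground hxI
  have hC := hb.2.fundCircuit_isCircuit hxE hxb
  obtain ⟨y, hyC, hyI⟩ := not_subset.1 fun h ↦ hC.not_indep (hI.subset h)
  obtain ⟨i, rfl⟩ : y ∈ range b :=
    (M.fundCircuit_subset_insert x (range b) hyC).resolve_left fun h ↦ hyI (h ▸ hxI)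
  have hstep := hb.exchange_update hxE hxb hyC
  have hss : I \ range (update b i x) ⊂ I \ range b := by
    refine (ssubset_iff_of_subset ?_).2 ⟨x, ⟨hxI, hxb⟩, fun h ↦ h.2 ⟨i, by simp⟩⟩
    rw [hb.1.range_update]
    grind
  obtain ⟨b', hb', hIb', hfix⟩ := ih _ (ncard_lt_ncard hss hIfin.sdiff) hstep.2.1 rfl
  refine ⟨b', .head hstep hb', hIb', fun k hk ↦ ?_⟩
  have hki : k ≠ i := by rintro rfl; exact hyI hk
  rw [hfix k (by rwa [update_of_ne hki]), update_of_ne hki]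

theorem IsLabelledBase.reflTransGen_comp_swap_of_sdiff_subset_range (hb : M.IsLabelledBase b)
    (hC : M.IsCircuit C) (hx : x ∈ C) (hCb : C \ {x} ⊆ range b) (hi : b i ∈ C) (hj : b j ∈ C)
    (hij : i ≠ j) : ReflTransGen M.LabelledExchange b (b ∘ Equiv.swap i j) := by
  obtain ⟨h₁, hs₁⟩ := hb.exchange_update_of_isCircuit hC hx hCb hi
  obtain ⟨h₂, hs₂⟩ := h₁.2.1.exchange_update_of_isCircuit (i := j) hC hi hs₁
    (by rwa [update_of_ne hij.symm])
  rw [update_of_ne hij.symm] at hs₂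
  obtain ⟨h₃, -⟩ := h₂.2.1.exchange_update_of_isCircuit (i := i) hC hj hs₂
    (by rwa [update_of_ne hij, update_self])
  have heq : b ∘ Equiv.swap i j = update (update (update b i x) j (b i)) i (b j) := by
    ext k
    by_cases hki : k = i
    · subst hki; simp
    · by_cases hkj : k = j
      · subst hkj; simp [hki]
      · simp [hki, hkj, Equiv.swap_apply_of_ne_of_ne]
  rw [heq]
  exact .tail (.tail (.single h₁) h₂) h₃

theorem IsLabelledBase.reflTransGen_comp_swap [M.Finitary] (hb : M.IsLabelledBase b)
    (h : M.SameComponent (b i) (b j)) :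
    ReflTransGen M.LabelledExchange b (b ∘ Equiv.swap i j) := by
  by_cases hij : i = j
  · subst hij; simp [ReflTransGen.refl]
  obtain ⟨C, hC, hi, hj⟩ := h.resolve_left fun h ↦ hij (hb.1 h)
  obtain ⟨x, hxC, hxb⟩ := not_subset.1 fun h ↦ hC.not_indep (hb.2.indep.subset h)
  have hne : ∀ k, b k ≠ x := fun k hk ↦ hxb ⟨k, hk⟩
  obtain ⟨b', hbb', hCb', hfix⟩ := hb.exists_reflTransGen_subset_range
    (hC.sdiff_singleton_indep hxC) hC.finite.sdiff
  have hfi := hfix i ⟨hi, hne i⟩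
  have hfj := hfix j ⟨hj, hne j⟩
  have hswap := (hb.of_reflTransGen hbb').reflTransGen_comp_swap_of_sdiff_subset_range hC hxC hCb'
    (hfi ▸ hi) (hfj ▸ hj) hij
  exact (hbb'.trans hswap).trans (LabelledExchange.reflTransGen_comp_equiv
    (LabelledExchange.reflTransGen_symm hbb') _)

theorem IsLabelledBase.reflTransGen_of_range_eq [M.Finitary] [Finite ι]
    (hb : M.IsLabelledBase b) (hb' : M.IsLabelledBase b') (hr : range b = range b')
    (h : ∀ k, M.SameComponent (b k) (b' k)) : ReflTransGen M.LabelledExchange b b' := by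
  induction hn : {k | b k ≠ b' k}.ncard using Nat.strong_induction_on generalizing b with
  | _ n ih =>
  subst hn
  by_cases heq : b = b'
  · subst heq; rfl
  obtain ⟨i, hi⟩ := ne_iff.1 heq
  obtain ⟨j, hj⟩ : b' i ∈ range b := hr ▸ mem_range_self i
  have hij : M.SameComponent (b i) (b j) := hj ▸ h i
  have hji : j ≠ i := by rintro rfl; exact hi hj
  have hjne : b j ≠ b' j := fun hjj ↦ hji (hb'.1 (hjj.symm.trans hj))
  refine (hb.reflTransGen_comp_swap hij).trans (ih _ (ncard_lt_ncard
    ((ssubset_iff_of_subset ?_).2 ⟨i, hi, ?_⟩) (toFinite _)) (hb.comp_equiv _) ?_ ?_ rfl)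
  · intro k hk
    by_cases hki : k = i
    · rw [hki]; exact hi
    by_cases hkj : k = j
    · rw [hkj]; exact hjne
    · simpa [Equiv.swap_apply_of_ne_of_ne hki hkj] using hk
  · simp [hj]
  · rw [(Equiv.swap i j).surjective.range_comp, hr]
  · intro k
    by_cases hki : k = i
    · subst hki; exact .inl (by simp [hj])
    by_cases hkj : k = j
    · subst hkj; simpa using hij.trans (h k)
    · simpa [Equiv.swap_apply_of_ne_of_ne hki hkj] using h k

/-- A labelled base can be reconfigured to another one exactly when the two elements with any given
label lie in the same connected component of the matroid. -/
theorem IsLabelledBase.reflTransGen_labelledExchange_iff [M.Finitary] [Finite ι]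
    (hb : M.IsLabelledBase b) (hb' : M.IsLabelledBase b') :
    ReflTransGen M.LabelledExchange b b' ↔ ∀ k, M.SameComponent (b k) (b' k) := by
  refine ⟨LabelledExchange.sameComponent_of_reflTransGen, fun h ↦ ?_⟩
  obtain ⟨c, hbc, hsub, -⟩ := hb.exists_reflTransGen_subset_range hb'.2.indep (finite_range b')
  have hc := hb.of_reflTransGen hbc
  refine hbc.trans (hc.reflTransGen_of_range_eq hb' (hb'.2.eq_of_subset_isBase hc.2 hsub).symm
    fun k ↦ ?_)
  exact (LabelledExchange.sameComponent_of_reflTransGen hbc k).symm.trans (h k)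

end Matroid

namespace SimpleGraph

variable {G : SimpleGraph V}

theorem fromEdgeSet_insert_eq_sup_edge (I : Set (Sym2 V)) (u v : V) :
    fromEdgeSet (insert s(u, v) I) = fromEdgeSet I ⊔ edge u v := by
  rw [edge, ← fromEdgeSet_union, union_singleton]

theorem Walk.IsPath.isAcyclic_fromEdgeSet_edges {u v : V} {p : G.Walk u v} (hp : p.IsPath) :
    (fromEdgeSet {e | e ∈ p.edges}).IsAcyclic := by
  induction p with
  | nil => simp
  | @cons u v w h p ih =>
    rw [Walk.cons_isPath_iff] at hp
    have hedges : {e | e ∈ (Walk.cons h p).edges} = insert s(u, v) {e | e ∈ p.edges} := by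
      ext e; simp
    rw [hedges, fromEdgeSet_insert_eq_sup_edge]
    refine (ih hp.1).sup_edge_of_not_reachable ?_
    rintro ⟨q⟩
    cases q with
    | nil => exact h.ne rfl
    | cons h' _ =>
      rw [fromEdgeSet_adj] at h'
      exact hp.2 (p.fst_mem_support_of_mem_edges h'.1)

/-- A cycle can be traversed starting with any of its edges. -/
theorem Walk.IsCycle.exists_cons_of_mem_edges {u : V} {c : G.Walk u u} (hc : c.IsCycle)
    {x : Sym2 V} (hx : x ∈ c.edges) :
    ∃ (a b : V) (h : G.Adj a b) (p : G.Walk b a), (Walk.cons h p).IsCycle ∧ x = s(a, b) ∧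
      ∀ e, e ∈ c.edges ↔ e ∈ (Walk.cons h p).edges := by
  classical
  induction x with | _ a b
  have ha : a ∈ c.support := c.fst_mem_support_of_mem_edges hx
  have hrot : ∀ e, e ∈ c.edges ↔ e ∈ (c.rotate a ha).edges := fun e ↦
    (c.rotate_edges a ha).mem_iff.symm
  have hc' := hc.rotate ha
  rw [hrot] at hx
  generalize c.rotate a ha = c' at *
  cases c' with
  | nil => simp at hx
  | @cons _ b' _ h p =>
    rcases List.mem_cons.1 (Walk.edges_cons h p ▸ hx) with hx' | hx'
    · exact ⟨a, b', h, p, hc', hx', hrot⟩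
    have hp : p.reverse.IsPath := ((Walk.cons_isCycle_iff p h).1 hc').1.reverse
    have hxp : s(a, b) ∈ p.reverse.edges := by simpa using hx'
    have hrev := hc'.reverse
    have hrot' : ∀ e, e ∈ c.edges ↔ e ∈ (Walk.cons h p).reverse.edges := fun e ↦ by
      rw [hrot, Walk.edges_reverse, List.mem_reverse]
    rw [Walk.reverse_cons] at hrev hrot'
    generalize p.reverse = r at *
    cases r with
    | nil => simp at hxp
    | @cons _ d _ h' q =>
      rw [Walk.cons_append] at hrev hrot'
      refine ⟨a, d, h', _, hrev, ?_, hrot'⟩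
      refine (List.mem_cons.1 (Walk.edges_cons h' q ▸ hxp)).resolve_right fun hq ↦ ?_
      exact ((Walk.cons_isPath_iff h' q).1 hp).2 (q.fst_mem_support_of_mem_edges hq)

theorem Walk.IsCycle.isAcyclic_fromEdgeSet_edges_sdiff {u : V} {c : G.Walk u u} (hc : c.IsCycle)
    {x : Sym2 V} (hx : x ∈ c.edges) : (fromEdgeSet ({e | e ∈ c.edges} \ {x})).IsAcyclic := by
  obtain ⟨a, b, h, p, hp, rfl, hedges⟩ := hc.exists_cons_of_mem_edges hx
  refine ((Walk.cons_isCycle_iff p h).1 hp).1.isAcyclic_fromEdgeSet_edges.anti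
    (fromEdgeSet_mono ?_)
  rintro e ⟨he, hne⟩
  have := (hedges e).1 he
  rw [Walk.edges_cons, List.mem_cons] at this
  exact this.resolve_left hne

theorem Walk.IsCycle.not_isAcyclic_fromEdgeSet_edges {u : V} {c : G.Walk u u} (hc : c.IsCycle) :
    ¬ (fromEdgeSet {e | e ∈ c.edges}).IsAcyclic := fun h ↦
  h _ (hc.transfer (H := fromEdgeSet {e | e ∈ c.edges}) fun e he ↦ by
    rw [edgeSet_fromEdgeSet]
    exact ⟨he, G.not_isDiag_of_mem_edgeSet (c.edges_subset_edgeSet he)⟩)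

theorem fromEdgeSet_le_of_subset_edgeSet {I : Set (Sym2 V)} (hI : I ⊆ G.edgeSet) :
    fromEdgeSet I ≤ G := by
  simpa using fromEdgeSet_mono hI

theorem edgeSet_fromEdgeSet_of_subset_edgeSet {I : Set (Sym2 V)} (hI : I ⊆ G.edgeSet) :
    (fromEdgeSet I).edgeSet = I := by
  rw [edgeSet_fromEdgeSet]
  exact sdiff_eq_left.2 (Set.disjoint_left.2 fun e he ↦ G.not_isDiag_of_mem_edgeSet (hI he))

theorem maximal_isAcyclic_fromEdgeSet_iff {I : Set (Sym2 V)} (hI : I ⊆ G.edgeSet)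
    (hacyc : (fromEdgeSet I).IsAcyclic) :
    Maximal (fun J ↦ J ⊆ G.edgeSet ∧ (fromEdgeSet J).IsAcyclic) I ↔
      (fromEdgeSet I).Reachable = G.Reachable := by
  rw [← maximal_isAcyclic_iff_reachable_eq (fromEdgeSet_le_of_subset_edgeSet hI) hacyc]
  constructor
  · refine fun h ↦ ⟨⟨fromEdgeSet_le_of_subset_edgeSet hI, hacyc⟩, fun F hF hle ↦ ?_⟩
    have hs : I ⊆ F.edgeSet :=
      (edgeSet_fromEdgeSet_of_subset_edgeSet hI).symm.subset.trans (edgeSet_mono hle)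
    have := h.2 (y := F.edgeSet) ⟨edgeSet_mono hF.1, by simpa using hF.2⟩ hs
    simpa using fromEdgeSet_mono this
  · refine fun h ↦ ⟨⟨hI, hacyc⟩, fun J hJ hle ↦ ?_⟩
    have := h.2 ⟨fromEdgeSet_le_of_subset_edgeSet hJ.1, hJ.2⟩ (fromEdgeSet_mono hle)
    have := edgeSet_mono this
    rwa [edgeSet_fromEdgeSet_of_subset_edgeSet hI, edgeSet_fromEdgeSet_of_subset_edgeSet hJ.1]
      at this

theorem exists_insert_isAcyclic_of_reachable_ne {I B : Set (Sym2 V)}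
    (hI : I ⊆ G.edgeSet) (hacyc : (fromEdgeSet I).IsAcyclic)
    (hIr : (fromEdgeSet I).Reachable ≠ G.Reachable) (hBr : (fromEdgeSet B).Reachable = G.Reachable) :
    ∃ x ∈ B \ I, (fromEdgeSet (insert x I)).IsAcyclic := by
  by_contra! hcon
  refine hIr ?_
  ext u v
  refine ⟨fun h ↦ h.mono (fromEdgeSet_le_of_subset_edgeSet hI), fun h ↦ ?_⟩
  rw [← hBr] at h
  obtain ⟨p⟩ := h
  induction p with
  | nil => exact .refl _
  | @cons u v w h p ih =>
    refine Reachable.trans ?_ ih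
    rw [fromEdgeSet_adj] at h
    by_cases huv : s(u, v) ∈ I
    · exact Adj.reachable ((fromEdgeSet_adj I).2 ⟨huv, h.2⟩)
    by_contra hr
    refine hcon _ ⟨h.1, huv⟩ ?_
    rw [fromEdgeSet_insert_eq_sup_edge]
    exact hacyc.sup_edge_of_not_reachable hr

/-- The cycle matroid of a finite graph: its independent sets are the edge sets of forests. -/
def cycleMatroid [Finite V] (G : SimpleGraph V) : Matroid (Sym2 V) :=
  (IndepMatroid.ofBdd G.edgeSet (fun I ↦ I ⊆ G.edgeSet ∧ (fromEdgeSet I).IsAcyclic)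
    (by simp)
    (fun _ _ hJ hIJ ↦ ⟨hIJ.trans hJ.1, hJ.2.anti (fromEdgeSet_mono hIJ)⟩)
    (fun I B hI hImax hB ↦ by
      rw [maximal_isAcyclic_fromEdgeSet_iff hI.1 hI.2] at hImax
      obtain ⟨x, hx, h⟩ := exists_insert_isAcyclic_of_reachable_ne hI.1 hI.2 hImax
        ((maximal_isAcyclic_fromEdgeSet_iff hB.1.1 hB.1.2).1 hB)
      exact ⟨x, hx, insert_subset (hB.1.1 hx.1) hI.1, h⟩)
    (fun _ hI ↦ hI.1)
    ⟨G.edgeSet.ncard, fun I hI ↦ by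
      rw [(toFinite G.edgeSet).cast_ncard_eq]
      exact encard_le_encard hI.1⟩).matroid

variable [Finite V]

@[simp]
theorem cycleMatroid_ground : G.cycleMatroid.E = G.edgeSet := rfl

@[simp]
theorem cycleMatroid_indep_iff {I : Set (Sym2 V)} :
    G.cycleMatroid.Indep I ↔ I ⊆ G.edgeSet ∧ (fromEdgeSet I).IsAcyclic := by
  simp [cycleMatroid]

theorem Connected.cycleMatroid_isBase_iff (hG : G.Connected) {B : Set (Sym2 V)} :
    G.cycleMatroid.IsBase B ↔ IsSpanningTreeOf G B := by
  rw [Matroid.isBase_iff_maximal_indep]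
  have hr := G.preconnected_iff_reachable_eq_top.mp hG.preconnected
  have := hG.nonempty
  constructor
  · intro h
    have hB := cycleMatroid_indep_iff.1 h.1
    rw [show G.cycleMatroid.Indep = _ from funext fun _ ↦ propext cycleMatroid_indep_iff,
      maximal_isAcyclic_fromEdgeSet_iff hB.1 hB.2, hr] at h
    exact ⟨hB.1, ⟨(preconnected_iff_reachable_eq_top _).2 h⟩, hB.2⟩
  · intro h
    rw [show G.cycleMatroid.Indep = _ from funext fun _ ↦ propext cycleMatroid_indep_iff,
      maximal_isAcyclic_fromEdgeSet_iff h.1 h.2.isAcyclic, hr]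
    exact (preconnected_iff_reachable_eq_top _).1 h.2.preconnected

theorem Walk.IsCycle.isCircuit_cycleMatroid {u : V} {c : G.Walk u u} (hc : c.IsCycle) :
    G.cycleMatroid.IsCircuit {e | e ∈ c.edges} := by
  rw [Matroid.isCircuit_iff_dep_forall_sdiff_singleton_indep]
  have hE : {e | e ∈ c.edges} ⊆ G.edgeSet := fun e he ↦ c.edges_subset_edgeSet he
  exact ⟨⟨fun h ↦ hc.not_isAcyclic_fromEdgeSet_edges (cycleMatroid_indep_iff.1 h).2, hE⟩,
    fun e he ↦ cycleMatroid_indep_iff.2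
      ⟨sdiff_subset.trans hE, hc.isAcyclic_fromEdgeSet_edges_sdiff he⟩⟩

theorem exists_isCycle_of_isCircuit_cycleMatroid {C : Set (Sym2 V)}
    (hC : G.cycleMatroid.IsCircuit C) :
    ∃ (v : V) (w : G.Walk v v), w.IsCycle ∧ {e | e ∈ w.edges} = C := by
  have hE : C ⊆ G.edgeSet := hC.subset_ground
  have hdep : ¬ (fromEdgeSet C).IsAcyclic := fun h ↦
    hC.not_indep (cycleMatroid_indep_iff.2 ⟨hE, h⟩)
  simp only [IsAcyclic, not_forall, not_not] at hdep
  obtain ⟨v, w, hw⟩ := hdep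
  have hwG := hw.mapLe (fromEdgeSet_le_of_subset_edgeSet hE)
  refine ⟨v, _, hwG, hC.eq_of_not_indep_subset hwG.isCircuit_cycleMatroid.not_indep ?_⟩
  intro e he
  have := w.edges_subset_edgeSet (by simpa using he)
  rwa [edgeSet_fromEdgeSet_of_subset_edgeSet hE] at this

theorem cycleMatroid_sameComponent_iff {e f : Sym2 V} :
    G.cycleMatroid.SameComponent e f ↔ SameBlock G e f := by
  refine or_congr_right ⟨?_, ?_⟩
  · rintro ⟨C, hC, he, hf⟩
    obtain ⟨v, w, hw, rfl⟩ := exists_isCycle_of_isCircuit_cycleMatroid hC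
    exact ⟨v, w, hw, he, hf⟩
  · rintro ⟨v, w, hw, he, hf⟩
    exact ⟨_, hw.isCircuit_cycleMatroid, he, hf⟩

end SimpleGraph

theorem exists_stepsIn_iff_reflTransGen {X : Type*} {step : X → X → Prop} {a b : X} :
    (∃ n, StepsIn step n a b) ↔ Relation.ReflTransGen step a b := by
  constructor
  · rintro ⟨n, h⟩
    induction n generalizing a with
    | zero => exact h ▸ .refl
    | succ n ih =>
      obtain ⟨c, hac, hcb⟩ := h
      exact .head hac (ih hcb)
  · intro h
    induction h using Relation.ReflTransGen.head_induction_on with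
    | refl => exact ⟨0, rfl⟩
    | head hac _ ih =>
      obtain ⟨n, hn⟩ := ih
      exact ⟨n + 1, _, hac, hn⟩

section

variable [Fintype V] {G : SimpleGraph V} {b b' : Fin (Fintype.card V - 1) → Sym2 V}

theorem SimpleGraph.Connected.isLabelledBase_cycleMatroid_iff (hG : G.Connected) :
    G.cycleMatroid.IsLabelledBase b ↔ IsLabelledSpanningTree G b :=
  and_congr_right fun _ ↦ hG.cycleMatroid_isBase_iff

theorem SimpleGraph.Connected.labelledExchange_cycleMatroid_iff (hG : G.Connected) :
    G.cycleMatroid.LabelledExchange b b' ↔ IsLabelledSpanningTree G b ∧ TreeStep G b b' := by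
  rw [Matroid.LabelledExchange, hG.isLabelledBase_cycleMatroid_iff,
    hG.isLabelledBase_cycleMatroid_iff]
  refine and_congr_right fun hb ↦ ⟨?_, ?_⟩
  · rintro ⟨hb', i, f, hf, rfl⟩
    exact ⟨i, f, hb'.2.1 ⟨i, by simp⟩, hf, hb'.2, rfl⟩
  · rintro ⟨i, f, -, hf, hT, rfl⟩
    exact ⟨⟨hb.1.update_of_notMem_range i hf, hT⟩, i, f, hf, rfl⟩

theorem SimpleGraph.Connected.reflTransGen_labelledExchange_cycleMatroid_iff (hG : G.Connected)
    (hb : IsLabelledSpanningTree G b) :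
    Relation.ReflTransGen G.cycleMatroid.LabelledExchange b b' ↔
      Relation.ReflTransGen (TreeStep G) b b' := by
  refine ⟨Relation.ReflTransGen.mono (fun _ _ h ↦
    (hG.labelledExchange_cycleMatroid_iff.1 h).2) _ _, fun h ↦ ?_⟩
  induction h using Relation.ReflTransGen.head_induction_on with
  | refl => exact .refl
  | head hac _ ih =>
    have hstep := hG.labelledExchange_cycleMatroid_iff.2 ⟨hb, hac⟩
    exact .head hstep (ih (hG.isLabelledBase_cycleMatroid_iff.1 hstep.2.1))

end

/-- For a connected graph `G`, one labelled spanning tree can be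
reconfigured to another by basis exchange steps iff for every label `i` the two edges
carrying label `i` lie in the same 2-connected component of `G`. -/
theorem labelled_spanning_tree_reconfigurable_iff [Fintype V] (G : SimpleGraph V)
    (hG : G.Connected) (b₁ b₂ : Fin (Fintype.card V - 1) → Sym2 V)
    (h₁ : IsLabelledSpanningTree G b₁) (h₂ : IsLabelledSpanningTree G b₂) :
    (∃ n, StepsIn (TreeStep G) n b₁ b₂) ↔ ∀ i, SameBlock G (b₁ i) (b₂ i) := by
  rw [exists_stepsIn_iff_reflTransGen, ← hG.reflTransGen_labelledExchange_cycleMatroid_iff h₁,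
    Matroid.IsLabelledBase.reflTransGen_labelledExchange_iff
      (hG.isLabelledBase_cycleMatroid_iff.2 h₁) (hG.isLabelledBase_cycleMatroid_iff.2 h₂)]
  simp only [SimpleGraph.cycleMatroid_sameComponent_iff]
end

section
/- There is an absolute constant c such that for every connected graph G on n vertices and every two labelled spanning trees T1 = (B1, l1) and T2 = (B2, l2) of G satisfying the condition that for every label i the edges l1⁻¹(i) and l2⁻¹(i) lie in the same 2-connected component of G, the labelled spanning tree T1 can be reconfigured to T2 using at most c·n² basis exchange steps. -/
open Set Function

universe u

variable {V : Type u}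

namespace StepsIn

variable {X : Type*} {step : X → X → Prop}

theorem single {a b : X} (h : step a b) : StepsIn step 1 a b :=
  ⟨b, h, rfl⟩

theorem trans {m n : ℕ} {a b c : X} (hab : StepsIn step m a b) (hbc : StepsIn step n b c) :
    StepsIn step (m + n) a c := by
  induction m generalizing a with
  | zero =>
    obtain rfl : a = b := hab
    simpa using hbc
  | succ m ih =>
    obtain ⟨d, had, hdb⟩ := hab
    rw [Nat.add_right_comm]
    exact ⟨d, had, ih hdb⟩

theorem mono {step' : X → X → Prop} (hstep : ∀ x y, step x y → step' x y) {n : ℕ} {a b : X}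
    (h : StepsIn step n a b) : StepsIn step' n a b := by
  induction n generalizing a with
  | zero => exact h
  | succ n ih =>
    obtain ⟨d, had, hdb⟩ := h
    exact ⟨d, hstep _ _ had, ih hdb⟩

end StepsIn

namespace VectorExchange

variable {K W E ι : Type*} [Field K] [AddCommGroup W] [Module K W]

/-- `b` is a labelled basis of the vector configuration `(v e)` indexed by `e ∈ S`. -/
structure IsBase (K : Type*) {W E ι : Type*} [Field K] [AddCommGroup W] [Module K W]
    (v : E → W) (S : Set E) (b : ι → E) : Prop where
  mem : ∀ i, b i ∈ S
  indep : LinearIndependent K (v ∘ b)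
  span : ∀ e ∈ S, v e ∈ Submodule.span K (range (v ∘ b))

/-- Replacing the element labelled `i` by a new element, keeping a labelled basis. -/
def Exchange (K : Type*) {W E ι : Type*} [Field K] [AddCommGroup W] [Module K W] [DecidableEq ι]
    (v : E → W) (S : Set E) (b b' : ι → E) : Prop :=
  ∃ i f, f ∉ range b ∧ IsBase K v S b' ∧ b' = update b i f

/-- A separator of the configuration: `S ∩ T` and `S \ T` span independent subspaces. -/
def IsSeparator (K : Type*) {W E : Type*} [Field K] [AddCommGroup W] [Module K W]
    (v : E → W) (S T : Set E) : Prop :=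
  Disjoint (Submodule.span K (v '' (S ∩ T))) (Submodule.span K (v '' (S \ T)))

/-- Two elements are linked if no separator distinguishes them. -/
def Linked (K : Type*) {W E : Type*} [Field K] [AddCommGroup W] [Module K W]
    (v : E → W) (S : Set E) (e f : E) : Prop :=
  ∀ T, IsSeparator K v S T → (e ∈ T ↔ f ∈ T)

variable {v : E → W} {S T : Set E} {b : ι → E}

theorem IsSeparator.compl (h : IsSeparator K v S T) : IsSeparator K v S Tᶜ := by
  unfold IsSeparator at *
  rw [sdiff_compl, ← sdiff_eq]
  exact h.symm

theorem Linked.symm {e f : E} (h : Linked K v S e f) : Linked K v S f e :=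
  fun T hT => (h T hT).symm

theorem Linked.trans {e f g : E} (h : Linked K v S e f) (h' : Linked K v S f g) :
    Linked K v S e g :=
  fun T hT => (h T hT).trans (h' T hT)

theorem IsBase.injective (hb : IsBase K v S b) : Injective b :=
  hb.indep.injective.of_comp

theorem IsBase.comp_perm (hb : IsBase K v S b) (σ : Equiv.Perm ι) : IsBase K v S (b ∘ σ) where
  mem i := hb.mem _
  indep := hb.indep.comp σ σ.injective
  span e he := by
    rw [← comp_assoc, σ.surjective.range_comp]
    exact hb.span e he

variable [Fintype ι]

theorem IsBase.exists_coeff (hb : IsBase K v S b) {e : E} (he : e ∈ S) :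
    ∃ c : ι → K, ∑ i, c i • v (b i) = v e :=
  (Submodule.mem_span_range_iff_exists_fun K).1 (hb.span e he)

theorem IsBase.coeff_unique (hb : IsBase K v S b) {c d : ι → K}
    (h : ∑ i, c i • v (b i) = ∑ i, d i • v (b i)) : c = d := by
  have := Fintype.linearIndependent_iff.1 hb.indep (fun i => c i - d i)
    (by simp [sub_smul, h])
  funext i
  exact sub_eq_zero.1 (this i)

theorem IsBase.coeff_self [DecidableEq ι] (hb : IsBase K v S b) {c : ι → K} {k : ι}
    (h : ∑ i, c i • v (b i) = v (b k)) : c = Pi.single k 1 :=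
  hb.coeff_unique (by rw [h]; simp [Pi.single_apply])

theorem IsBase.update_of_coeff_ne_zero [DecidableEq ι] (hb : IsBase K v S b) {f : E}
    (hf : f ∈ S) {c : ι → K} (hc : ∑ i, c i • v (b i) = v f) {i : ι} (hi : c i ≠ 0) :
    IsBase K v S (update b i f) := by
  set U := Submodule.span K (range (v ∘ update b i f))
  have hfU : v f ∈ U := Submodule.subset_span ⟨i, by simp⟩
  have hjU : ∀ j, j ≠ i → v (b j) ∈ U := fun j hj => Submodule.subset_span ⟨j, by simp [hj]⟩
  have hiU : v (b i) ∈ U := by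
    have : c i • v (b i) = v f - ∑ j ∈ Finset.univ.erase i, c j • v (b j) := by
      rw [← hc, ← Finset.add_sum_erase _ _ (Finset.mem_univ i)]
      abel
    rw [← Submodule.smul_mem_iff U hi, this]
    exact U.sub_mem hfU (U.sum_mem fun j hj => U.smul_mem _ (hjU j (Finset.ne_of_mem_erase hj)))
  have hle : Submodule.span K (range (v ∘ b)) ≤ U := by
    rw [Submodule.span_le]
    rintro _ ⟨j, rfl⟩
    by_cases hj : j = i
    · exact hj ▸ hiU
    · exact hjU j hj
  refine ⟨fun j => ?_, ?_, fun e he => hle (hb.span e he)⟩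
  · by_cases hj : j = i
    · subst hj; simpa using hf
    · simpa [hj] using hb.mem j
  · rw [linearIndependent_iff_card_le_finrank_span, Set.finrank,
      linearIndependent_iff_card_eq_finrank_span.1 hb.indep]
    have : FiniteDimensional K U := FiniteDimensional.span_of_finite K (Set.toFinite _)
    exact Submodule.finrank_mono hle

theorem IsBase.exchange [DecidableEq ι] (hb : IsBase K v S b) {f : E} (hf : f ∈ S)
    (hfb : f ∉ range b) {c : ι → K} (hc : ∑ i, c i • v (b i) = v f) {i : ι} (hi : c i ≠ 0) :
    Exchange K v S b (update b i f) :=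
  ⟨i, f, hfb, hb.update_of_coeff_ne_zero hf hc hi, rfl⟩

/-- The indices `i` and `j` both occur in the expansion of some configuration vector. -/
def CommonCircuit (K : Type*) {W E ι : Type*} [Field K] [AddCommGroup W] [Module K W] [Fintype ι]
    (v : E → W) (S : Set E) (b : ι → E) (i j : ι) : Prop :=
  ∃ f ∈ S, ∃ c : ι → K, ∑ k, c k • v (b k) = v f ∧ c i ≠ 0 ∧ c j ≠ 0

/-- The graph on labels whose edges are pairs occurring in a common fundamental circuit. -/
def circuitGraph (K : Type*) {W E ι : Type*} [Field K] [AddCommGroup W] [Module K W] [Fintype ι]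
    (v : E → W) (S : Set E) (b : ι → E) : SimpleGraph ι where
  Adj i j := i ≠ j ∧ CommonCircuit K v S b i j
  symm := ⟨fun _ _ ⟨h, f, hf, c, hc, hi, hj⟩ => ⟨h.symm, f, hf, c, hc, hj, hi⟩⟩
  loopless := ⟨fun _ h => h.1 rfl⟩

theorem mem_span_image_of_support {e : E} {c : ι → K}
    (hc : ∑ i, c i • v (b i) = v e) {I : Set ι} (hI : ∀ i, c i ≠ 0 → i ∈ I) :
    v e ∈ Submodule.span K ((v ∘ b) '' I) := by
  rw [← hc]
  refine Submodule.sum_mem _ fun i _ => ?_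
  by_cases hi : c i = 0
  · simp [hi]
  · exact Submodule.smul_mem _ _ (Submodule.subset_span ⟨i, hI i hi, rfl⟩)

/-- Linked basis elements are joined by a chain of fundamental circuits. -/
theorem IsBase.reachable_of_linked (hb : IsBase K v S b) {i j : ι}
    (h : Linked K v S (b i) (b j)) : (circuitGraph K v S b).Reachable i j := by
  set I : Set ι := {k | (circuitGraph K v S b).Reachable i k}
  set T : Set E := {e | v e ∈ Submodule.span K ((v ∘ b) '' I)}
  have hdis := hb.indep.disjoint_span_image (disjoint_compl_right (a := I))
  have hsep : IsSeparator K v S T := by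
    refine hdis.mono ?_ ?_
    · rw [Submodule.span_le]
      rintro _ ⟨e, he, rfl⟩
      exact he.2
    · rw [Submodule.span_le]
      rintro _ ⟨e, ⟨heS, heT⟩, rfl⟩
      obtain ⟨c, hc⟩ := hb.exists_coeff heS
      refine mem_span_image_of_support hc fun k hk hkI => heT ?_
      refine mem_span_image_of_support hc fun l hl => ?_
      by_cases hkl : k = l
      · exact hkl ▸ hkI
      · exact SimpleGraph.Reachable.trans hkI
          (SimpleGraph.Adj.reachable ⟨hkl, e, heS, c, hc, hk, hl⟩)
  have hi : b i ∈ T := Submodule.subset_span ⟨i, SimpleGraph.Reachable.refl i, rfl⟩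
  have hj : b j ∈ T := (h T hsep).1 hi
  by_contra hn
  have h0 : v (b j) = 0 :=
    Submodule.disjoint_def.1 hdis _ hj (Submodule.subset_span ⟨j, hn, rfl⟩)
  exact hb.indep.ne_zero j h0

/-- An element is linked to every basis element in its fundamental circuit. -/
theorem IsBase.linked_of_coeff_ne_zero (hb : IsBase K v S b) {f : E} (hf : f ∈ S) {c : ι → K}
    (hc : ∑ i, c i • v (b i) = v f) {i : ι} (hi : c i ≠ 0) : Linked K v S (b i) f := by
  classical
  have key : ∀ T, IsSeparator K v S T → f ∈ T → b i ∈ T := by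
    intro T hT hfT
    by_contra hiT
    set x := ∑ k with b k ∉ T, c k • v (b k)
    have hx' : x = v f - ∑ k with b k ∈ T, c k • v (b k) := by
      rw [← hc, ← Finset.sum_filter_add_sum_filter_not Finset.univ (fun k => b k ∈ T)]
      abel
    have h1 : x ∈ Submodule.span K (v '' (S \ T)) :=
      Submodule.sum_mem _ fun k hk => Submodule.smul_mem _ _
        (Submodule.subset_span ⟨b k, ⟨hb.mem k, (Finset.mem_filter.1 hk).2⟩, rfl⟩)
    have h2 : x ∈ Submodule.span K (v '' (S ∩ T)) := by
      rw [hx']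
      refine Submodule.sub_mem _ (Submodule.subset_span ⟨f, ⟨hf, hfT⟩, rfl⟩)
        (Submodule.sum_mem _ fun k hk => Submodule.smul_mem _ _
        (Submodule.subset_span ⟨b k, ⟨hb.mem k, (Finset.mem_filter.1 hk).2⟩, rfl⟩))
    have h0 : x = 0 := Submodule.disjoint_def.1 hT _ h2 h1
    exact hi (linearIndependent_iff'.1 hb.indep _ c h0 i (by simp [hiT]))
  refine fun T hT => ⟨fun h => ?_, key T hT⟩
  by_contra hfT
  exact key _ hT.compl hfT h

theorem IsBase.swap_steps [DecidableEq ι] (hb : IsBase K v S b) {i j : ι} (hij : i ≠ j)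
    (h : CommonCircuit K v S b i j) : StepsIn (Exchange K v S) 3 b (b ∘ Equiv.swap i j) := by
  obtain ⟨f, hf, c, hc, hi, hj⟩ := h
  have hfb : f ∉ range b := by
    rintro ⟨k, rfl⟩
    rw [hb.coeff_self hc] at hi hj
    have : i = k := by by_contra h; simp [h] at hi
    have : j = k := by by_contra h; simp [h] at hj
    grind
  have hbi := hb.injective
  refine ⟨_, hb.exchange hf hfb hc hi, update (update b i f) j (b i), ?_, b ∘ Equiv.swap i j, ?_,
    rfl⟩
  · refine ⟨j, b i, ?_, ?_, rfl⟩
    · rintro ⟨k, hk⟩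
      by_cases hki : k = i
      · subst hki
        exact hfb ⟨k, by simpa using hk.symm⟩
      · rw [update_of_ne hki] at hk
        exact hki (hbi hk)
    · have h1 := (hb.update_of_coeff_ne_zero hf hc hj).comp_perm (Equiv.swap i j)
      convert h1 using 1
      funext k
      by_cases hkj : k = j
      · subst hkj; simp [hij]
      · by_cases hki : k = i
        · subst hki; simp [hkj]
        · simp [hkj, hki, Equiv.swap_apply_of_ne_of_ne]
  · refine ⟨i, b j, ?_, hb.comp_perm _, ?_⟩
    · rintro ⟨k, hk⟩
      by_cases hkj : k = j
      · subst hkj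
        exact hij (hbi (by simpa using hk))
      · by_cases hki : k = i
        · subst hki
          exact hfb ⟨j, by simpa [hkj] using hk.symm⟩
        · exact hkj (hbi (by simpa [hkj, hki] using hk))
    · funext k
      by_cases hki : k = i
      · subst hki; simp
      · by_cases hkj : k = j
        · subst hkj; simp [hki]
        · simp [hkj, hki, Equiv.swap_apply_of_ne_of_ne]

theorem CommonCircuit.comp_perm {i j : ι} (h : CommonCircuit K v S b i j) (τ : Equiv.Perm ι) :
    CommonCircuit K v S (b ∘ τ) (τ.symm i) (τ.symm j) := by
  obtain ⟨f, hf, c, hc, hi, hj⟩ := h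
  refine ⟨f, hf, c ∘ τ, ?_, by simpa, by simpa⟩
  rw [← hc]
  exact Equiv.sum_comp τ fun k => c k • v (b k)

theorem IsBase.swap_steps_comp_perm [DecidableEq ι] (hb : IsBase K v S b) {i j : ι} (hij : i ≠ j)
    (h : CommonCircuit K v S b i j) (τ : Equiv.Perm ι) :
    StepsIn (Exchange K v S) 3 (b ∘ τ) (b ∘ (Equiv.swap i j * τ)) := by
  have := (hb.comp_perm τ).swap_steps (τ.symm.injective.ne hij) (h.comp_perm τ)
  convert this using 1
  funext k
  have := Equiv.swap_apply_apply τ.symm i j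
  simp [this]

/-- Transposing the elements at the ends of a path in the circuit graph. -/
theorem IsBase.swap_steps_of_isPath [DecidableEq ι] (hb : IsBase K v S b) {i j : ι}
    (p : (circuitGraph K v S b).Walk i j) (hp : p.IsPath) (τ : Equiv.Perm ι) :
    ∃ n ≤ 6 * p.length, StepsIn (Exchange K v S) n (b ∘ τ) (b ∘ (Equiv.swap i j * τ)) := by
  induction p generalizing τ with
  | nil => exact ⟨0, by simp, by simp [StepsIn]⟩
  | @cons i k j hik p ih =>
    rw [SimpleGraph.Walk.cons_isPath_iff] at hp
    have hij : i ≠ j := by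
      rintro rfl
      exact hp.2 p.end_mem_support
    have hs := fun τ => hb.swap_steps_comp_perm hik.1 hik.2 τ
    by_cases hkj : k = j
    · subst hkj
      exact ⟨3, by simp; omega, hs τ⟩
    · obtain ⟨n, hn, hsn⟩ := ih hp.1 (Equiv.swap i k * τ)
      refine ⟨3 + n + 3, by simp; omega, ?_⟩
      have h := ((hs τ).trans hsn).trans (hs _)
      convert h using 2
      rw [← mul_assoc, ← mul_assoc]
      congr 2
      rw [Equiv.swap_comm i k, Equiv.swap_comm k j,
        Equiv.swap_mul_swap_mul_swap (Ne.symm hkj) (Ne.symm hij),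
        Equiv.swap_comm]

theorem IsBase.swap_steps_of_linked [DecidableEq ι] (hb : IsBase K v S b) {i j : ι}
    (h : Linked K v S (b i) (b j)) (τ : Equiv.Perm ι) :
    ∃ n ≤ 6 * Fintype.card ι,
      StepsIn (Exchange K v S) n (b ∘ τ) (b ∘ (Equiv.swap i j * τ)) := by
  obtain ⟨p, hp⟩ := (hb.reachable_of_linked h).exists_isPath
  obtain ⟨n, hn, hs⟩ := hb.swap_steps_of_isPath p hp τ
  have := hp.length_lt
  exact ⟨n, by omega, hs⟩

/-- Sorting the labels of a fixed basis. -/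
theorem IsBase.perm_steps [DecidableEq ι] (hb : IsBase K v S b) (τ : Equiv.Perm ι)
    (h : ∀ i, Linked K v S (b (τ i)) (b i)) :
    ∃ n ≤ τ.support.card * (6 * Fintype.card ι), StepsIn (Exchange K v S) n (b ∘ τ) b := by
  induction hk : τ.support.card using Nat.strong_induction_on generalizing τ with
  | _ k ih =>
    subst hk
    by_cases hτ : τ = 1
    · subst hτ
      exact ⟨0, by simp, rfl⟩
    · obtain ⟨i, hi⟩ : ∃ i, τ i ≠ i := by
        by_contra! hc
        exact hτ (Equiv.ext hc)
      have hlt := Equiv.Perm.card_support_swap_mul hi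
      obtain ⟨n, hn, hs⟩ := hb.swap_steps_of_linked (h i).symm τ
      obtain ⟨m, hm, hs'⟩ := ih _ hlt (Equiv.swap i (τ i) * τ) (fun j => by
        refine Linked.trans ?_ (h j)
        rw [Equiv.Perm.mul_apply, Equiv.swap_apply_def]
        split_ifs with h1 h2
        · rw [h1]; exact h i
        · rw [h2]; exact (h i).symm
        · exact fun _ _ => Iff.rfl) rfl
      refine ⟨n + m, ?_, hs.trans hs'⟩
      calc n + m ≤ (Equiv.swap i (τ i) * τ).support.card.succ * (6 * Fintype.card ι) := by
            rw [Nat.succ_mul]; omega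
        _ ≤ _ := Nat.mul_le_mul_right _ hlt

/-- Ignoring labels, any basis can be moved onto any other. -/
theorem IsBase.exists_steps_range_subset [DecidableEq ι] {b₁ b₂ : ι → E} (h₁ : IsBase K v S b₁)
    (h₂ : IsBase K v S b₂) :
    ∃ n ≤ {i | b₁ i ∉ range b₂}.ncard, ∃ b, StepsIn (Exchange K v S) n b₁ b ∧ IsBase K v S b ∧
      range b ⊆ range b₂ ∧ ∀ i, Linked K v S (b i) (b₁ i) := by
  induction hk : {i | b₁ i ∉ range b₂}.ncard using Nat.strong_induction_on generalizing b₁ with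
  | _ k ih =>
    subst hk
    by_cases hsub : range b₁ ⊆ range b₂
    · exact ⟨0, by simp, b₁, rfl, h₁, hsub, fun _ _ _ => Iff.rfl⟩
    obtain ⟨i, hi⟩ : ∃ i, b₁ i ∉ range b₂ := by
      by_contra! hc
      exact hsub (range_subset_iff.2 hc)
    obtain ⟨j, c, hc, hci⟩ : ∃ j, ∃ c : ι → K, ∑ k, c k • v (b₁ k) = v (b₂ j) ∧ c i ≠ 0 := by
      by_contra! hcon
      choose c hc using fun j => h₁.exists_coeff (h₂.mem j)
      obtain ⟨d, hd⟩ := h₂.exists_coeff (h₁.mem i)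
      have : ∑ k, (∑ j, d j * c j k) • v (b₁ k) = v (b₁ i) := by
        simp_rw [← hd, ← hc, Finset.smul_sum, Finset.sum_smul, smul_smul]
        exact Finset.sum_comm
      have h1 := congrFun (h₁.coeff_self this) i
      simp [fun j => hcon j _ (hc j)] at h1
    have hjb : b₂ j ∉ range b₁ := by
      rintro ⟨k, hk⟩
      rw [← hk] at hc
      rw [h₁.coeff_self hc] at hci
      have : i = k := by by_contra h; simp [h] at hci
      exact hi ⟨j, by rw [this, hk]⟩
    have hlt : {k | update b₁ i (b₂ j) k ∉ range b₂}.ncard < {k | b₁ k ∉ range b₂}.ncard := by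
      refine Set.ncard_lt_ncard ⟨fun k hk => ?_, fun h => ?_⟩ (Set.toFinite _)
      · by_cases hki : k = i
        · subst hki; exact hi
        · simpa [hki] using hk
      · exact h hi ⟨j, by simp⟩
    obtain ⟨n, hn, b, hs, hb, hr, hl⟩ := ih _ hlt (h₁.update_of_coeff_ne_zero (h₂.mem j) hc hci) rfl
    refine ⟨1 + n, by omega, b, (StepsIn.single (h₁.exchange (h₂.mem j) hjb hc hci)).trans hs, hb,
      hr, fun k => (hl k).trans ?_⟩
    by_cases hki : k = i
    · subst hki
      simpa using (h₁.linked_of_coeff_ne_zero (h₂.mem j) hc hci).symm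
    · rw [update_of_ne hki]
      exact fun _ _ => Iff.rfl

/-- Labelled bases with linked corresponding elements can be reconfigured in quadratically many
exchanges. -/
theorem IsBase.exists_steps [DecidableEq ι] {b₁ b₂ : ι → E} (h₁ : IsBase K v S b₁)
    (h₂ : IsBase K v S b₂) (h : ∀ i, Linked K v S (b₁ i) (b₂ i)) :
    ∃ n ≤ Fintype.card ι + Fintype.card ι * (6 * Fintype.card ι),
      StepsIn (Exchange K v S) n b₁ b₂ := by
  obtain ⟨n, hn, b, hs, hb, hr, hl⟩ := h₁.exists_steps_range_subset h₂
  choose σ hσ using fun i => hr ⟨i, rfl⟩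
  have hσi : Injective σ := fun i j hij => hb.injective (by rw [← hσ, ← hσ, hij])
  set τ : Equiv.Perm ι := Equiv.ofBijective σ (Finite.injective_iff_bijective.1 hσi)
  have hbτ : b = b₂ ∘ τ := funext fun i => (hσ i).symm
  obtain ⟨m, hm, hs'⟩ := h₂.perm_steps τ (fun i => by
    have : b₂ (τ i) = b i := hσ i
    rw [this]
    exact (hl i).trans (h i))
  refine ⟨n + m, add_le_add (hn.trans ?_) (hm.trans (Nat.mul_le_mul_right _ ?_)),
    hs.trans (hbτ ▸ hs')⟩
  · rw [← Nat.card_eq_fintype_card]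
    exact Set.ncard_le_card _
  · exact Finset.card_le_univ _

end VectorExchange

namespace SimpleGraph

variable [DecidableEq V]

/-- The vector of an edge in the incidence space over `ZMod 2`. -/
def edgeVec (e : Sym2 V) : V → ZMod 2 :=
  e.lift ⟨fun x y => Pi.single x 1 + Pi.single y 1, fun _ _ => add_comm _ _⟩

theorem edgeVec_mk (x y : V) : edgeVec s(x, y) = Pi.single x 1 + Pi.single y 1 :=
  rfl

theorem edgeVec_apply_of_notMem {e : Sym2 V} {x : V} (h : x ∉ e) : edgeVec e x = 0 := by
  induction e with
  | _ y z =>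
    rw [Sym2.mem_iff, not_or] at h
    simp [edgeVec_mk, h.1, h.2]

theorem edgeVec_add_edgeVec (x y z : V) :
    edgeVec s(x, y) + edgeVec s(y, z) = Pi.single x 1 + Pi.single z 1 := by
  rw [edgeVec_mk, edgeVec_mk, add_assoc, ← add_assoc (Pi.single y 1), ZModModule.add_self,
    zero_add]

theorem Walk.sum_edgeVec {G : SimpleGraph V} {x y : V} (p : G.Walk x y) :
    (p.edges.map edgeVec).sum = Pi.single x 1 + Pi.single y 1 := by
  induction p with
  | nil => simp [ZModModule.add_self]
  | @cons x y z h p ih =>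
    rw [Walk.edges_cons, List.map_cons, List.sum_cons, ih, ← edgeVec_mk, edgeVec_add_edgeVec]

theorem Walk.IsPath.filter_edges_eq_nil {G : SimpleGraph V} {x y : V} {p : G.Walk x y}
    (hp : p.IsPath) (P : Sym2 V → Bool) (h : ((p.edges.filter P).map edgeVec).sum = 0) :
    p.edges.filter P = [] := by
  induction p with
  | nil => simp
  | @cons x y z hxy p ih =>
    rw [Walk.cons_isPath_iff] at hp
    rw [Walk.edges_cons, List.filter_cons] at h ⊢
    split_ifs at h ⊢ with hP
    · have h0 : ((p.edges.filter P).map edgeVec).sum x = 0 := by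
        refine (map_list_sum (Pi.evalAddMonoidHom (fun _ : V => ZMod 2) x) _).trans ?_
        refine List.sum_eq_zero ?_
        simp only [List.mem_map, List.mem_filter]
        rintro _ ⟨_, ⟨e, he, rfl⟩, rfl⟩
        exact edgeVec_apply_of_notMem fun hxe => hp.2 (p.mem_support_of_mem_edges he.1 hxe)
      have h1 := congrFun h x
      simp [h0, edgeVec_mk, hxy.ne] at h1
    · exact ih hp.1 h

open VectorExchange in
theorem linked_of_isCycle {G : SimpleGraph V} {x : V} {w : G.Walk x x} (hw : w.IsCycle)
    {e f : Sym2 V} (he : e ∈ w.edges) (hf : f ∈ w.edges) :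
    Linked (ZMod 2) edgeVec G.edgeSet e f := by
  classical
  have key : ∀ T, IsSeparator (ZMod 2) edgeVec G.edgeSet T → ∀ e ∈ w.edges, ∀ f ∈ w.edges,
      e ∈ T → f ∈ T := by
    intro T hT e he f hf heT
    by_contra hfT
    have hmem : ∀ (P : Sym2 V → Bool) (A : Set (Sym2 V)), (∀ g ∈ G.edgeSet, P g → g ∈ A) →
        ((w.edges.filter P).map edgeVec).sum ∈ Submodule.span (ZMod 2) (edgeVec '' A) := by
      intro P A hPA
      refine list_sum_mem fun y hy => ?_
      simp only [List.mem_map, List.mem_filter] at hy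
      obtain ⟨g, ⟨hg, hPg⟩, rfl⟩ := hy
      exact Submodule.subset_span ⟨g, hPA g (w.edges_subset_edgeSet hg) hPg, rfl⟩
    have h1 := hmem (· ∈ T) (G.edgeSet ∩ T) (by simp +contextual)
    have h2 := hmem (· ∉ T) (G.edgeSet \ T) (by simp +contextual)
    have hsum : ((w.edges.filter (· ∈ T)).map edgeVec).sum +
        ((w.edges.filter (· ∉ T)).map edgeVec).sum = 0 := by
      have h := w.sum_edgeVec
      rw [ZModModule.add_self] at h
      rw [← h, ← List.sum_append, ← List.map_append]
      refine ((List.Perm.map _ ?_).sum_eq)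
      simpa using List.filter_append_perm (· ∈ T) w.edges
    rw [add_eq_zero_iff_eq_neg, ZModModule.neg_eq_self] at hsum
    have h0 : ((w.edges.filter (· ∈ T)).map edgeVec).sum = 0 :=
      Submodule.disjoint_def.1 hT _ h1 (hsum ▸ h2)
    have h0' := hsum ▸ h0
    cases w with
    | nil => simp at he
    | cons h p =>
      rw [Walk.cons_isCycle_iff] at hw
      rw [Walk.edges_cons, List.filter_cons] at h0 h0'
      rw [Walk.edges_cons, List.mem_cons] at he hf
      split_ifs at h0 h0' with ha hb hb
      · simp_all
      · have := hw.1.filter_edges_eq_nil _ h0'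
        rw [List.filter_eq_nil_iff] at this
        simp only [decide_eq_true_eq, not_not] at this ha
        rcases hf with rfl | hf
        exacts [hfT ha, hfT (this f hf)]
      · have := hw.1.filter_edges_eq_nil _ h0
        rw [List.filter_eq_nil_iff] at this
        simp only [decide_eq_true_eq] at this ha
        rcases he with rfl | he
        exacts [ha heT, this e he heT]
      · simp_all
  exact fun T hT => ⟨key T hT e he f hf, key T hT f hf e he⟩

theorem Reachable.single_add_single_mem {T : SimpleGraph V} {x y : V} (h : T.Reachable x y) :
    Pi.single x 1 + Pi.single y 1 ∈ Submodule.span (ZMod 2) (edgeVec '' T.edgeSet) := by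
  obtain ⟨p⟩ := h
  rw [← p.sum_edgeVec]
  refine list_sum_mem fun z hz => ?_
  obtain ⟨e, he, rfl⟩ := List.mem_map.1 hz
  exact Submodule.subset_span ⟨e, p.edges_subset_edgeSet he, rfl⟩

theorem reachable_of_edgeVec_mem [Fintype V] {T : SimpleGraph V} {x y : V}
    (h : edgeVec s(x, y) ∈ Submodule.span (ZMod 2) (edgeVec '' T.edgeSet)) : T.Reachable x y := by
  classical
  set φ := Fintype.linearCombination (ZMod 2) (fun z => if T.Reachable x z then (1 : ZMod 2) else 0)
  have hφ : Submodule.span (ZMod 2) (edgeVec '' T.edgeSet) ≤ LinearMap.ker φ := by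
    rw [Submodule.span_le]
    rintro _ ⟨e, he, rfl⟩
    induction e with
    | _ a c =>
      have hac : T.Reachable x a ↔ T.Reachable x c :=
        ⟨fun h => h.trans (Adj.reachable he), fun h => h.trans (Adj.reachable he).symm⟩
      simp [φ, edgeVec_mk, Fintype.linearCombination_apply_single, hac, ZModModule.add_self]
  have h0 := hφ h
  by_contra hxy
  simp [φ, edgeVec_mk, Fintype.linearCombination_apply_single, hxy] at h0

theorem linearIndependent_edgeVec [Fintype V] {b : Fin (Fintype.card V - 1) → Sym2 V}
    (hc : (fromEdgeSet (range b)).Connected) : LinearIndependent (ZMod 2) (edgeVec ∘ b) := by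
  obtain ⟨r⟩ := hc.nonempty
  set U := Submodule.span (ZMod 2) (range (edgeVec ∘ b))
  set R := Submodule.span (ZMod 2) {(Pi.single r 1 : V → ZMod 2)}
  have htop : U ⊔ R = ⊤ := by
    rw [eq_top_iff, ← (Pi.basisFun (ZMod 2) V).span_eq, Submodule.span_le]
    rintro _ ⟨x, rfl⟩
    have h1 : Pi.single r 1 ∈ U ⊔ R := Submodule.mem_sup_right (Submodule.mem_span_singleton_self _)
    have h2 : Pi.single x 1 + Pi.single r 1 ∈ U ⊔ R := by
      refine Submodule.mem_sup_left (Submodule.span_mono ?_ (hc x r).single_add_single_mem)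
      rw [range_comp, edgeSet_fromEdgeSet]
      exact image_mono sdiff_subset
    have := (U ⊔ R).sub_mem h2 h1
    simpa using this
  have hle := Submodule.finrank_add_le_finrank_add_finrank U R
  rw [htop, finrank_top, Module.finrank_fintype_fun_eq_card] at hle
  have hR := finrank_span_singleton (K := ZMod 2) (v := (Pi.single r 1 : V → ZMod 2)) (by simp)
  rw [linearIndependent_iff_card_le_finrank_span, Fintype.card_fin]
  change _ ≤ Module.finrank (ZMod 2) U
  change Module.finrank (ZMod 2) R = 1 at hR
  omega

open VectorExchange

theorem isBase_iff [Fintype V] {G : SimpleGraph V} (hG : G.Connected)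
    {b : Fin (Fintype.card V - 1) → Sym2 V} :
    IsBase (ZMod 2) edgeVec G.edgeSet b ↔ IsLabelledSpanningTree G b := by
  constructor
  · intro hb
    have hsub : range b ⊆ G.edgeSet := range_subset_iff.2 hb.mem
    have hset : (fromEdgeSet (range b)).edgeSet = range b := by
      rw [edgeSet_fromEdgeSet, sdiff_eq_left, Set.disjoint_left]
      exact fun e he hd => G.not_isDiag_of_mem_edgeSet (hsub he) hd
    refine ⟨hb.injective, hsub, ?_⟩
    rw [isTree_iff_connected_and_card, hset]
    have := hG.nonempty
    refine ⟨⟨fun x y => ?_⟩, ?_⟩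
    · obtain ⟨p⟩ := hG x y
      induction p with
      | nil => rfl
      | cons h p ih =>
        refine Reachable.trans (reachable_of_edgeVec_mem ?_) ih
        rw [hset, ← range_comp]
        exact hb.span _ h
    · rw [Nat.card_range_of_injective hb.injective, Nat.card_fin, Nat.card_eq_fintype_card]
      have := Fintype.card_pos (α := V)
      omega
  · rintro ⟨-, hsub, hT⟩
    refine ⟨range_subset_iff.1 hsub, linearIndependent_edgeVec hT.connected, fun e he => ?_⟩
    induction e with
    | _ x y =>
      refine Submodule.span_mono ?_ (hT.connected x y).single_add_single_mem
      rw [range_comp, edgeSet_fromEdgeSet]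
      exact image_mono sdiff_subset

theorem linked_of_sameBlock {G : SimpleGraph V} {e f : Sym2 V} (h : SameBlock G e f) :
    Linked (ZMod 2) edgeVec G.edgeSet e f := by
  obtain rfl | ⟨x, w, hw, he, hf⟩ := h
  · exact fun _ _ => Iff.rfl
  · exact linked_of_isCycle hw he hf

theorem treeStep_of_exchange [Fintype V] {G : SimpleGraph V} (hG : G.Connected)
    {b b' : Fin (Fintype.card V - 1) → Sym2 V}
    (h : Exchange (ZMod 2) edgeVec G.edgeSet b b') : TreeStep G b b' := by
  obtain ⟨i, f, hf, hb, rfl⟩ := h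
  exact ⟨i, f, by simpa using hb.mem i, hf, ((isBase_iff hG).1 hb).2, rfl⟩

end SimpleGraph

/-- There is an absolute constant `c` such that whenever the
reconfiguration condition holds (each label's two edges share a 2-connected component),
one labelled spanning tree can be reconfigured to the other in at most `c·n²` basis
exchange steps. -/
theorem labelled_spanning_tree_reconfiguration_quadratic :
    ∃ c : ℕ, ∀ (V : Type u) [Fintype V] (G : SimpleGraph V), G.Connected →
      ∀ b₁ b₂ : Fin (Fintype.card V - 1) → Sym2 V,
        IsLabelledSpanningTree G b₁ → IsLabelledSpanningTree G b₂ →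
        (∀ i, SameBlock G (b₁ i) (b₂ i)) →
        ∃ n, n ≤ c * Fintype.card V ^ 2 ∧ StepsIn (TreeStep G) n b₁ b₂ := by
  classical
  refine ⟨7, fun V _ G hG b₁ b₂ h₁ h₂ h => ?_⟩
  obtain ⟨n, hn, hs⟩ := ((SimpleGraph.isBase_iff hG).2 h₁).exists_steps
    ((SimpleGraph.isBase_iff hG).2 h₂) fun i => SimpleGraph.linked_of_sameBlock (h i)
  refine ⟨n, hn.trans ?_, hs.mono fun _ _ => SimpleGraph.treeStep_of_exchange hG⟩
  rw [Fintype.card_fin]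
  have : Fintype.card V - 1 ≤ Fintype.card V := Nat.sub_le _ _
  nlinarith [Nat.le_self_pow two_ne_zero (Fintype.card V)]
end

section
/- Let G be a connected graph, B a spanning tree of G with labelling l, and let e1 and e2 be two distinct edges of B that lie on a common cycle C of G. Let t = |E(C) \ E(B)| be the number of edges of C not in B (so t ≥ 1). Then there is a sequence of at most 6t − 3 basis exchange steps that transforms (B, l) into (B, l'), where l'(e1) = l(e2), l'(e2) = l(e1), and l' agrees with l on all other edges of B. -/
open Set Function

universe u

variable {V : Type u}

section Acyclicity

variable {G H : SimpleGraph V}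

/-- The edges of a path span an acyclic graph. -/
theorem SimpleGraph.Walk.IsPath.isAcyclic_fromEdgeSet_edges_s2 {u v : V} {p : G.Walk u v}
    (hp : p.IsPath) : (SimpleGraph.fromEdgeSet {e | e ∈ p.edges}).IsAcyclic := by
  induction p with
  | nil => simp
  | @cons u x v h p ih =>
    rw [SimpleGraph.Walk.cons_isPath_iff] at hp
    have hedges : SimpleGraph.fromEdgeSet {e | e ∈ (SimpleGraph.Walk.cons h p).edges} =
        SimpleGraph.fromEdgeSet {e | e ∈ p.edges} ⊔ SimpleGraph.edge u x := by
      ext a b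
      simp only [SimpleGraph.fromEdgeSet_adj, SimpleGraph.sup_adj, SimpleGraph.edge_adj,
        SimpleGraph.Walk.edges_cons, List.mem_cons, Set.mem_ofPred_eq, Sym2.eq_iff]
      tauto
    rw [hedges]
    refine (ih hp.1).sup_edge_of_not_reachable fun hr => hp.2 ?_
    obtain ⟨q⟩ := hr
    cases q with
    | nil => exact absurd rfl h.ne
    | cons hy _ => exact p.fst_mem_support_of_mem_edges ((SimpleGraph.fromEdgeSet_adj _).1 hy).1

/-- An edge of a cycle can be taken to be its first step. -/
theorem SimpleGraph.Walk.IsCycle.exists_isCycle_snd_eq {v x y : V} {w : G.Walk v v}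
    (hw : w.IsCycle) (h : s(x, y) ∈ w.edges) :
    ∃ c : G.Walk x x, c.IsCycle ∧ c.snd = y ∧ ∀ e, e ∈ c.edges ↔ e ∈ w.edges := by
  classical
  have hx := w.fst_mem_support_of_mem_edges h
  have hc := hw.rotate hx
  have hmem : ∀ e, e ∈ (w.rotate x hx).edges ↔ e ∈ w.edges := fun e =>
    (w.rotate_edges x hx).mem_iff
  have hy : y ∈ (w.rotate x hx).toSubgraph.neighborSet x := by
    simpa [SimpleGraph.Walk.adj_toSubgraph_iff_mem_edges, hmem] using h
  rw [hc.neighborSet_toSubgraph_endpoint] at hy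
  obtain rfl | hy := hy
  · exact ⟨_, hc, rfl, hmem⟩
  · refine ⟨_, hc.reverse, ?_, by simpa using hmem⟩
    rw [SimpleGraph.Walk.snd_reverse]
    exact hy.symm

/-- A cycle whose edges all lie on another cycle uses every edge of that cycle. -/
theorem SimpleGraph.Walk.IsCycle.mem_edges_of_edges_subset {v u : V} {w : G.Walk v v}
    (hw : w.IsCycle) {c : H.Walk u u} (hc : c.IsCycle) (hcw : c.edges ⊆ w.edges)
    {g : Sym2 V} (hg : g ∈ w.edges) : g ∈ c.edges := by
  by_contra hgc
  induction g with | _ x y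
  obtain ⟨d, hd, rfl, hdw⟩ := hw.exists_isCycle_snd_eq hg
  cases d with
  | nil => simp at hd
  | cons h p =>
    have hpath := ((SimpleGraph.Walk.cons_isCycle_iff _ _).1 hd).1
    have hcp : ∀ e ∈ c.edges, e ∈ p.edges := fun e he => by
      have := (hdw e).2 (hcw he)
      rw [SimpleGraph.Walk.edges_cons, List.mem_cons] at this
      refine this.resolve_left ?_
      rintro rfl
      exact hgc (by simpa using he)
    refine hpath.isAcyclic_fromEdgeSet_edges_s2 _ (hc.transfer (H := _) fun e he => ?_)
    rw [SimpleGraph.edgeSet_fromEdgeSet]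
    exact ⟨hcp e he, H.not_isDiag_of_mem_edgeSet (c.edges_subset_edgeSet he)⟩

/-- Adding an edge to a connected graph and then removing an edge of a cycle keeps it
connected. -/
theorem SimpleGraph.connected_fromEdgeSet_insert_diff_singleton {S : Set (Sym2 V)}
    (hS : (SimpleGraph.fromEdgeSet S).Connected) {e f : Sym2 V} {v : V} {c : H.Walk v v}
    (hc : c.IsCycle) (hsub : ∀ a ∈ c.edges, a ∈ insert f S) (he : e ∈ c.edges) :
    (SimpleGraph.fromEdgeSet (insert f S \ {e})).Connected := by
  have hconn : (SimpleGraph.fromEdgeSet (insert f S)).Connected :=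
    hS.mono (SimpleGraph.fromEdgeSet_mono (Set.subset_insert f S))
  have htrans : ∀ a ∈ c.edges, a ∈ (SimpleGraph.fromEdgeSet (insert f S)).edgeSet := fun a ha => by
    rw [SimpleGraph.edgeSet_fromEdgeSet]
    exact ⟨hsub a ha, H.not_isDiag_of_mem_edgeSet (c.edges_subset_edgeSet ha)⟩
  induction e with | _ x y
  have hbridge : ¬ (SimpleGraph.fromEdgeSet (insert f S)).IsBridge s(x, y) := fun hb =>
    hb.notMem_edges_of_isCycle (hc.transfer htrans) (by simpa using he)
  refine (hconn.connected_delete_edge_of_not_isBridge hbridge).mono fun a b hab => ?_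
  rw [SimpleGraph.deleteEdges_adj, SimpleGraph.fromEdgeSet_adj] at hab
  exact (SimpleGraph.fromEdgeSet_adj _).2 ⟨⟨hab.1.1, hab.2⟩, hab.1.2⟩

/-- Adding an edge to a spanning tree creates a cycle. -/
theorem SimpleGraph.IsTree.exists_isCycle_insert {S : Set (Sym2 V)}
    (hS : (SimpleGraph.fromEdgeSet S).IsTree) {f : Sym2 V} (hf : f ∉ S) (hd : ¬ f.IsDiag) :
    ∃ (v : V) (c : (SimpleGraph.fromEdgeSet (insert f S)).Walk v v), c.IsCycle := by
  induction f with | _ x y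
  by_contra! hno
  have hadd : SimpleGraph.fromEdgeSet (insert s(x, y) S) =
      SimpleGraph.fromEdgeSet S ⊔ SimpleGraph.edge x y := by
    ext a b
    simp only [SimpleGraph.fromEdgeSet_adj, SimpleGraph.sup_adj, SimpleGraph.edge_adj,
      Set.mem_insert_iff, Sym2.eq_iff]
    tauto
  have hac : (SimpleGraph.fromEdgeSet S ⊔ SimpleGraph.edge x y).IsAcyclic := by
    rw [← hadd]
    exact fun v c hc => hno v c hc
  obtain h | h := (SimpleGraph.isAcyclic_sup_fromEdgeSet_iff.1 hac).2 (hS.connected x y)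
  · exact hd h
  · exact hf ((SimpleGraph.fromEdgeSet_adj _).1 h).1

end Acyclicity

section Steps

theorem StepsIn.concat {X : Type*} {step : X → X → Prop} {n : ℕ} {a b c : X}
    (h : StepsIn step n a b) (hbc : step b c) : StepsIn step (n + 1) a c := by
  induction n generalizing a with
  | zero => exact ⟨c, by cases h; exact hbc, rfl⟩
  | succ n ih =>
    obtain ⟨d, had, hdb⟩ := h
    exact ⟨d, had, ih hdb⟩

variable [Fintype V] {G H : SimpleGraph V} {b b' : Fin (Fintype.card V - 1) → Sym2 V}

theorem range_update_of_injective {ι α : Type*} [DecidableEq ι] {g : ι → α}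
    (hg : Injective g) {f : α} (hf : f ∉ Set.range g) (k : ι) :
    Set.range (update g k f) = insert f (Set.range g) \ {g k} := by
  ext e
  constructor
  · rintro ⟨l, rfl⟩
    obtain rfl | hl := eq_or_ne l k
    · rw [update_self]
      exact ⟨Set.mem_insert _ _, fun h => hf ⟨l, h.symm⟩⟩
    · rw [update_of_ne hl]
      exact ⟨Set.mem_insert_of_mem _ ⟨l, rfl⟩, fun h => hl (hg h)⟩
  · rintro ⟨rfl | ⟨l, rfl⟩, he⟩
    · exact ⟨k, update_self _ _ _⟩
    · exact ⟨l, update_of_ne (fun h => he (by rw [h]; rfl)) _ _⟩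

theorem injective_update_of_notMem_range {ι α : Type*} [DecidableEq ι] {g : ι → α}
    (hg : Injective g) {f : α} (hf : f ∉ Set.range g) (k : ι) : Injective (update g k f) := by
  intro l m h
  have hne (l : ι) : g l ≠ f := fun h => hf ⟨l, h⟩
  grind [update_apply, Injective]

/-- A connected spanning subgraph with injectively labelled edges is a labelled spanning tree. -/
theorem isLabelledSpanningTree_of_connected (hinj : Injective b) (hsub : Set.range b ⊆ G.edgeSet)
    (hconn : (SimpleGraph.fromEdgeSet (Set.range b)).Connected) :
    IsLabelledSpanningTree G b := by
  refine ⟨hinj, hsub, SimpleGraph.isTree_iff_connected_and_card.2 ⟨hconn, ?_⟩⟩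
  have hdiag : (SimpleGraph.fromEdgeSet (Set.range b)).edgeSet = Set.range b := by
    rw [SimpleGraph.edgeSet_fromEdgeSet]
    exact sdiff_eq_left.2 (Set.disjoint_left.2 fun e he =>
      G.not_isDiag_of_mem_edgeSet (hsub he))
  have := hconn.nonempty
  have hpos : 0 < Fintype.card V := Fintype.card_pos
  rw [hdiag, Nat.card_range_of_injective hinj, Nat.card_fin, Nat.card_eq_fintype_card]
  omega

/-- Exchanging a tree edge for a non-tree edge along a cycle. -/
theorem IsLabelledSpanningTree.exchange (hb : IsLabelledSpanningTree G b) {f : Sym2 V}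
    (hfG : f ∈ G.edgeSet) (hf : f ∉ Set.range b) {v : V} {c : H.Walk v v} (hc : c.IsCycle)
    (hsub : ∀ e ∈ c.edges, e ∈ insert f (Set.range b)) {k : Fin (Fintype.card V - 1)}
    (hk : b k ∈ c.edges) :
    IsLabelledSpanningTree G (update b k f) ∧ TreeStep G b (update b k f) := by
  have hrange := range_update_of_injective hb.1 hf k
  have hlab : IsLabelledSpanningTree G (update b k f) := by
    refine isLabelledSpanningTree_of_connected (injective_update_of_notMem_range hb.1 hf k) ?_ ?_
    · rw [hrange]
      exact Set.sdiff_subset.trans (Set.insert_subset hfG hb.2.1)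
    · rw [hrange]
      exact SimpleGraph.connected_fromEdgeSet_insert_diff_singleton hb.2.2.connected hc hsub hk
  exact ⟨hlab, k, f, hfG, hf, hlab.2, rfl⟩

theorem TreeStep.symm (hb : IsLabelledSpanningTree G b) (h : TreeStep G b b') :
    TreeStep G b' b := by
  obtain ⟨k, f, -, hf, -, rfl⟩ := h
  have hupd : update (update b k f) k (b k) = b := by simp
  refine ⟨k, b k, hb.2.1 ⟨k, rfl⟩, ?_, by rw [hupd]; exact hb.2, hupd.symm⟩
  rw [range_update_of_injective hb.1 hf]
  exact fun h => h.2 rfl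

theorem TreeStep.comp_equiv (h : TreeStep G b b') (σ : Equiv.Perm (Fin (Fintype.card V - 1))) :
    TreeStep G (b ∘ σ) (b' ∘ σ) := by
  obtain ⟨k, f, hfG, hf, htree, rfl⟩ := h
  have hupd : update b k f ∘ σ = update (b ∘ σ) (σ.symm k) f := update_comp_equiv b σ k f
  refine ⟨σ.symm k, f, hfG, by rwa [σ.surjective.range_comp], ?_, hupd⟩
  rwa [← hupd, σ.surjective.range_comp]

/-- If the cycle has a single edge outside the tree, three steps swap two labels on it. -/
theorem stepsIn_three_swap (hb : IsLabelledSpanningTree G b) {i j : Fin (Fintype.card V - 1)}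
    (hij : i ≠ j) {v : V} {w : G.Walk v v} (hw : w.IsCycle) (hi : b i ∈ w.edges)
    (hj : b j ∈ w.edges) {f : Sym2 V} (hf : f ∈ w.edges) (hfb : f ∉ Set.range b)
    (hsub : ∀ e ∈ w.edges, e ∈ insert f (Set.range b)) :
    StepsIn (TreeStep G) 3 b (b ∘ Equiv.swap i j) := by
  have hG := fun e (he : e ∈ w.edges) => w.edges_subset_edgeSet he
  have hbij : b i ≠ b j := hb.1.ne hij
  obtain ⟨h₁, s₁⟩ := hb.exchange (hG f hf) hfb hw hsub hi
  have r₁ := range_update_of_injective hb.1 hfb i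
  have n₁ : b i ∉ Set.range (update b i f) := by
    rw [r₁]
    exact fun h => h.2 rfl
  have hsub₁ : ∀ e ∈ w.edges, e ∈ insert (b i) (Set.range (update b i f)) := by
    intro e he
    rw [r₁, Set.insert_sdiff_singleton]
    exact Set.mem_insert_of_mem _ (hsub e he)
  have k₁ : update b i f j = b j := update_of_ne hij.symm _ _
  obtain ⟨h₂, s₂⟩ := h₁.exchange (hG _ hi) n₁ hw hsub₁ (k := j) (by rwa [k₁])
  have r₂ := range_update_of_injective h₁.1 n₁ j
  rw [k₁] at r₂
  have n₂ : b j ∉ Set.range (update (update b i f) j (b i)) := by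
    rw [r₂]
    exact fun h => h.2 rfl
  have hsub₂ : ∀ e ∈ w.edges, e ∈ insert (b j) (Set.range (update (update b i f) j (b i))) := by
    intro e he
    rw [r₂, Set.insert_sdiff_singleton]
    exact Set.mem_insert_of_mem _ (hsub₁ e he)
  have k₂ : update (update b i f) j (b i) i = f := by
    rw [update_of_ne hij, update_self]
  obtain ⟨-, s₃⟩ := h₂.exchange (hG _ hj) n₂ hw hsub₂ (k := i) (by rwa [k₂])
  refine ⟨_, s₁, _, s₂, _, s₃, ?_⟩
  rw [Equiv.comp_swap_eq_update]
  ext1 l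
  by_cases hl : l = i <;> by_cases hm : l = j <;> simp_all [update_apply]

/-- A cycle with at least two edges outside the tree admits an exchange that brings one of them
into the tree and keeps all tree edges of the cycle. -/
theorem IsLabelledSpanningTree.exists_exchange_off_cycle (hb : IsLabelledSpanningTree G b) {v : V}
    {w : G.Walk v v} (hw : w.IsCycle) {f g : Sym2 V} (hf : f ∈ w.edges) (hfb : f ∉ Set.range b)
    (hg : g ∈ w.edges) (hgb : g ∉ Set.range b) (hfg : f ≠ g) :
    ∃ k, b k ∉ w.edges ∧ IsLabelledSpanningTree G (update b k f) ∧
      TreeStep G b (update b k f) := by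
  have hfG := w.edges_subset_edgeSet hf
  obtain ⟨u, c, hc⟩ := hb.2.2.exists_isCycle_insert hfb (G.not_isDiag_of_mem_edgeSet hfG)
  have hsub : ∀ e ∈ c.edges, e ∈ insert f (Set.range b) := fun e he => by
    have := c.edges_subset_edgeSet he
    rw [SimpleGraph.edgeSet_fromEdgeSet] at this
    exact this.1
  obtain ⟨e, hec, hew⟩ : ∃ e ∈ c.edges, e ∉ w.edges := by
    by_contra! hcw
    obtain rfl | h := hsub g (hw.mem_edges_of_edges_subset hc (fun e he => hcw e he) hg)
    · exact hfg rfl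
    · exact hgb h
  obtain rfl | ⟨k, rfl⟩ := hsub e hec
  · exact absurd hf hew
  · exact ⟨k, hew, hb.exchange hfG hfb hc hsub hec⟩

end Steps

/-- A cycle with `t + 1` edges outside the tree allows swapping two labels on it in `2t + 3`
steps. -/
theorem stepsIn_swap_of_ncard [Fintype V] {G : SimpleGraph V}
    {i j : Fin (Fintype.card V - 1)} (hij : i ≠ j) {v : V} {w : G.Walk v v} (hw : w.IsCycle)
    (t : ℕ) (b : Fin (Fintype.card V - 1) → Sym2 V) (hb : IsLabelledSpanningTree G b)
    (hi : b i ∈ w.edges) (hj : b j ∈ w.edges)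
    (ht : ({e | e ∈ w.edges} \ Set.range b).ncard = t + 1) :
    StepsIn (TreeStep G) (2 * t + 3) b (b ∘ Equiv.swap i j) := by
  induction t generalizing b with
  | zero =>
    obtain ⟨f, hf⟩ := Set.ncard_eq_one.1 ht
    have hfm : f ∈ {e | e ∈ w.edges} \ Set.range b := hf ▸ rfl
    refine stepsIn_three_swap hb hij hw hi hj hfm.1 hfm.2 fun e he => ?_
    by_cases heb : e ∈ Set.range b
    · exact Set.mem_insert_of_mem _ heb
    · have : e ∈ ({f} : Set (Sym2 V)) := hf ▸ ⟨he, heb⟩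
      exact Or.inl this
  | succ t ih =>
    obtain ⟨f, g, hf, hg, hfg⟩ := (Set.one_lt_ncard_iff (Set.toFinite _)).1
      (show 1 < ({e | e ∈ w.edges} \ Set.range b).ncard by omega)
    obtain ⟨k, hk, hlab, hstep⟩ := hb.exists_exchange_off_cycle hw hf.1 hf.2 hg.1 hg.2 hfg
    have hki : i ≠ k := fun h => hk (h ▸ hi)
    have hkj : j ≠ k := fun h => hk (h ▸ hj)
    have hdiff : {e | e ∈ w.edges} \ Set.range (update b k f) =
        ({e | e ∈ w.edges} \ Set.range b) \ {f} := by
      rw [range_update_of_injective hb.1 hf.2 k]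
      ext e
      have : e ∈ w.edges → e ≠ b k := fun he h => hk (h ▸ he)
      simp only [Set.mem_sdiff, Set.mem_insert_iff, Set.mem_singleton_iff, Set.mem_ofPred_eq]
      tauto
    have hsteps := ih (update b k f) hlab (by rwa [update_of_ne hki]) (by rwa [update_of_ne hkj])
      (by rw [hdiff, Set.ncard_sdiff_singleton_of_mem hf, ht]; rfl)
    exact ⟨_, hstep, hsteps.concat ((hstep.symm hb).comp_equiv _)⟩

/-- If the two distinct tree edges carrying labels `i` and `j` lie on a
common cycle `w` of `G`, and `t` is the number of edges of the cycle not in the tree, then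
at most `6t − 3` basis exchange steps swap the two labels, leaving all other labels (and
the tree) unchanged. -/
theorem swap_labels_along_cycle [Fintype V] (G : SimpleGraph V) (hG : G.Connected)
    (b : Fin (Fintype.card V - 1) → Sym2 V) (hb : IsLabelledSpanningTree G b)
    (i j : Fin (Fintype.card V - 1)) (hij : b i ≠ b j)
    (v : V) (w : G.Walk v v) (hw : w.IsCycle)
    (hi : b i ∈ w.edges) (hj : b j ∈ w.edges)
    (t : ℕ) (ht : t = ({e | e ∈ w.edges} \ Set.range b).ncard) :
    ∃ n, n ≤ 6 * t - 3 ∧ StepsIn (TreeStep G) n b (b ∘ Equiv.swap i j) := by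
  have hpos : t ≠ 0 := by
    rintro rfl
    have hempty := (Set.ncard_eq_zero (Set.toFinite _)).1 ht.symm
    refine hb.2.2.isAcyclic _ (hw.transfer (H := _) fun e he => ?_)
    rw [SimpleGraph.edgeSet_fromEdgeSet]
    exact ⟨Set.sdiff_eq_empty.1 hempty he,
      G.not_isDiag_of_mem_edgeSet (w.edges_subset_edgeSet he)⟩
  obtain ⟨m, rfl⟩ := Nat.exists_eq_succ_of_ne_zero hpos
  exact ⟨2 * m + 3, by omega,
    stepsIn_swap_of_ncard (fun h => hij (congrArg b h)) hw m b hb hi hj ht.symm⟩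
end

section
/- Every 2-connected graph G with m edges contains a cycle C such that every block of the contracted graph G/C has at most m/2 edges. -/
open Set Function

universe u

variable {V : Type u}

/-- `G` is 2-connected: it is connected, has at least 3 vertices, and remains connected
after the deletion of any single vertex. -/
def TwoConnected [Fintype V] (G : SimpleGraph V) : Prop :=
  3 ≤ Fintype.card V ∧ G.Connected ∧ ∀ v : V, (G.induce {w | w ≠ v}).Connected

/-- Two edges `e, f ∈ E(G) \ E(C)` lie in the same block of the contraction `G/C` of the
cycle `C` (given as a closed walk `w`): this holds iff `e = f` or some cycle of the
multigraph `G/C` contains both.  Cycles of `G/C` correspond in `G` either to cycles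
meeting the vertex set of `C` in at most one vertex, or to paths whose two distinct
endpoints lie on `C` and which are internally disjoint from `C`. -/
def SameBlockContract (G : SimpleGraph V) {v : V} (w : G.Walk v v) (e f : Sym2 V) : Prop :=
  e = f ∨
    (∃ (u : V) (w' : G.Walk u u), w'.IsCycle ∧ e ∈ w'.edges ∧ f ∈ w'.edges ∧
      ({x | x ∈ w'.support} ∩ {x | x ∈ w.support}).Subsingleton) ∨
    (∃ (x y : V) (p : G.Walk x y), p.IsPath ∧ x ≠ y ∧ x ∈ w.support ∧ y ∈ w.support ∧
      (∀ z ∈ p.support, z ∈ w.support → z = x ∨ z = y) ∧ e ∈ p.edges ∧ f ∈ p.edges)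

namespace SimpleGraph

variable {G : SimpleGraph V}

/-- The vertices that can be reached from `k` by a walk avoiding `W`. -/
def reachAvoiding (G : SimpleGraph V) (W : Set V) (k : V) : Set V :=
  {a | ∃ p : G.Walk k a, ∀ z ∈ p.support, z ∉ W}

/-- The edges of `G` with an endpoint reachable from `k` by a walk avoiding `W`. -/
def bridgeEdges (G : SimpleGraph V) (W : Set V) (k : V) : Set (Sym2 V) :=
  {f | f ∈ G.edgeSet ∧ ∃ a ∈ f, a ∈ G.reachAvoiding W k}

section reachAvoiding

variable {W : Set V} {k a b : V}

lemma mem_reachAvoiding_self (hk : k ∉ W) : k ∈ G.reachAvoiding W k :=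
  ⟨.nil, by simpa using hk⟩

lemma notMem_of_mem_reachAvoiding (h : a ∈ G.reachAvoiding W k) : a ∉ W :=
  let ⟨p, hp⟩ := h
  hp a p.end_mem_support

lemma reachAvoiding_trans (hab : a ∈ G.reachAvoiding W k) (hb : b ∈ G.reachAvoiding W a) :
    b ∈ G.reachAvoiding W k := by
  obtain ⟨p, hp⟩ := hab
  obtain ⟨q, hq⟩ := hb
  refine ⟨p.append q, fun z hz => ?_⟩
  rcases (Walk.mem_support_append_iff _ _).1 hz with h | h
  exacts [hp z h, hq z h]

lemma reachAvoiding_symm (h : a ∈ G.reachAvoiding W k) : k ∈ G.reachAvoiding W a := by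
  obtain ⟨p, hp⟩ := h
  exact ⟨p.reverse, fun z hz => hp z (by simpa using hz)⟩

lemma mem_reachAvoiding_of_adj (ha : a ∈ G.reachAvoiding W k) (hab : G.Adj a b) (hb : b ∉ W) :
    b ∈ G.reachAvoiding W k :=
  reachAvoiding_trans ha ⟨.cons hab .nil, by
    simpa using ⟨notMem_of_mem_reachAvoiding ha, hb⟩⟩

/-- If `W'` contains every vertex of `W` adjacent to the `W`-component of `k`, then `W'` separates
this component from the rest of the graph. -/
lemma reachAvoiding_subset_of_attachments {W' : Set V}
    (hW' : ∀ x ∈ W, ∀ b ∈ G.reachAvoiding W k, G.Adj b x → x ∈ W')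
    (ha : a ∈ G.reachAvoiding W k) : G.reachAvoiding W' a ⊆ G.reachAvoiding W k := by
  rintro c ⟨p, hp⟩
  by_contra hc
  obtain ⟨d, hd, h1, h2⟩ := p.exists_boundary_dart _ ha hc
  have hdW : d.snd ∈ W := by
    by_contra h
    exact h2 (mem_reachAvoiding_of_adj h1 d.adj h)
  exact hp _ (p.dart_snd_mem_support_of_mem_darts hd) (hW' _ hdW _ h1 d.adj)

end reachAvoiding

namespace Walk

/-- A path meeting `A` has a terminal segment starting in `A` and covering all vertices of `A`
on the path. -/
lemma IsPath.exists_suffix_covering {a x : V} {p : G.Walk a x} (hp : p.IsPath) (A : Set V)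
    (hA : ∃ y ∈ p.support, y ∈ A) :
    ∃ y ∈ A, ∃ r : G.Walk y x, r.IsPath ∧ r.support ⊆ p.support ∧
      ∀ z ∈ p.support, z ∈ A → z ∈ r.support := by
  induction p with
  | nil =>
    obtain ⟨y, hy, hyA⟩ := hA
    obtain rfl : y = _ := by simpa using hy
    exact ⟨y, hyA, .nil, by simp, by simp, by simp⟩
  | @cons u _ _ h q ih =>
    by_cases hu : u ∈ A
    · exact ⟨u, hu, .cons h q, hp, fun _ => id, fun _ hz _ => hz⟩
    · obtain ⟨y, hy, hyA⟩ := hA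
      have hyq : y ∈ q.support := by
        rcases List.mem_cons.1 (by simpa using hy) with rfl | h
        exacts [absurd hyA hu, h]
      obtain ⟨y', hy', r, hr, hrs, hrA⟩ := ih hp.of_cons ⟨y, hyq, hyA⟩
      refine ⟨y', hy', r, hr, fun z hz => by simp [hrs hz], fun z hz hzA => ?_⟩
      rcases List.mem_cons.1 (by simpa using hz) with rfl | h
      exacts [absurd hzA hu, hrA z h hzA]

lemma IsPath.edges_eq_of_mem_edges {x y : V} {p : G.Walk x y} (hp : p.IsPath)
    (h : s(x, y) ∈ p.edges) : p.edges = [s(x, y)] := by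
  cases p with
  | nil => simp at h
  | @cons _ v _ hadj q =>
    rw [cons_isPath_iff] at hp
    rw [edges_cons, List.mem_cons] at h
    rcases h with h | h
    · obtain rfl : y = v := by
        rcases Sym2.eq_iff.1 h with ⟨-, h⟩ | ⟨h, -⟩
        exacts [h, absurd h hadj.ne]
      rw [(isPath_iff_nil.1 hp.1).eq_nil]
      simp
    · exact absurd (q.fst_mem_support_of_mem_edges h) hp.2

lemma IsPath.mem_reachAvoiding_start {x y a : V} {W : Set V} {p : G.Walk x y} (hp : p.IsPath)
    (hW : ∀ z ∈ p.support, z ∈ W → z = y) (ha : a ∈ p.support) (haW : a ∉ W) :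
    a ∈ G.reachAvoiding W x := by
  classical
  refine ⟨p.takeUntil a ha, fun z hz hzW => ?_⟩
  obtain rfl := hW z (p.support_takeUntil_subset_support ha hz) hzW
  exact endpoint_notMem_support_takeUntil hp ha (by rintro rfl; exact haW hzW) hz

/-- All vertices outside `W` on a path internally disjoint from `W` lie in the same component
of the complement of `W`. -/
lemma IsPath.mem_reachAvoiding {x y a k : V} {W : Set V} {p : G.Walk x y} (hp : p.IsPath)
    (hW : ∀ z ∈ p.support, z ∈ W → z = x ∨ z = y) (ha : a ∈ p.support) (haW : a ∉ W)
    (hk : k ∈ p.support) (hkW : k ∉ W) : a ∈ G.reachAvoiding W k := by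
  by_cases hx : x ∈ W
  · cases p with
    | nil =>
      obtain rfl : a = x := by simpa using ha
      exact absurd hx haW
    | cons h q =>
      rw [cons_isPath_iff] at hp
      have hq : ∀ z ∈ q.support, z ∈ W → z = y := fun z hz hzW => by
        rcases hW z (by simp [hz]) hzW with rfl | h
        exacts [absurd hz hp.2, h]
      have key : ∀ b, b ∈ (Walk.cons h q).support → b ∉ W → b ∈ q.support := fun b hb hbW => by
        rcases List.mem_cons.1 (by simpa using hb) with rfl | h
        exacts [absurd hx hbW, h]
      exact reachAvoiding_trans (reachAvoiding_symm
        (hp.1.mem_reachAvoiding_start hq (key k hk hkW) hkW))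
        (hp.1.mem_reachAvoiding_start hq (key a ha haW) haW)
  · have hq : ∀ z ∈ p.support, z ∈ W → z = y := fun z hz hzW => by
      rcases hW z hz hzW with rfl | h
      exacts [absurd hzW hx, h]
    exact reachAvoiding_trans (reachAvoiding_symm (hp.mem_reachAvoiding_start hq hk hkW))
      (hp.mem_reachAvoiding_start hq ha haW)

/-- All vertices outside `W` on a cycle meeting `W` at most once lie in the same component
of the complement of `W`. -/
lemma IsCycle.mem_reachAvoiding {u a k : V} {W : Set V} {c : G.Walk u u} (hc : c.IsCycle)
    (hW : ({z | z ∈ c.support} ∩ W).Subsingleton) (ha : a ∈ c.support) (haW : a ∉ W)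
    (hk : k ∈ c.support) (hkW : k ∉ W) : a ∈ G.reachAvoiding W k := by
  classical
  have based : ∀ {s : V} {c : G.Walk s s}, c.IsCycle → (∀ z ∈ c.support, z ∈ W → z = s) →
      a ∈ c.support → k ∈ c.support → a ∈ G.reachAvoiding W k := by
    intro s c hc hs ha hk
    cases c with
    | nil => exact absurd hc (by simp)
    | cons h q =>
      have hq := ((cons_isCycle_iff q h).1 hc).1
      have key : ∀ b, b ∈ (Walk.cons h q).support → b ∈ q.support := fun b hb => by
        rcases List.mem_cons.1 (by simpa using hb) with rfl | h
        exacts [q.end_mem_support, h]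
      exact hq.mem_reachAvoiding (fun z hz hzW => Or.inr (hs z (by simp [hz]) hzW))
        (key a ha) haW (key k hk) hkW
  by_cases h : ∃ s ∈ c.support, s ∈ W
  · obtain ⟨s, hs, hsW⟩ := h
    exact based (hc.rotate hs)
      (fun z hz hzW => hW ⟨(c.mem_support_rotate_iff s hs).1 hz, hzW⟩ ⟨hs, hsW⟩)
      ((c.mem_support_rotate_iff s hs).2 ha) ((c.mem_support_rotate_iff s hs).2 hk)
  · push Not at h
    exact based hc (fun z hz hzW => absurd hzW (h z hz)) ha hk

lemma IsCycle.exists_ne_mem_support {v : V} {w : G.Walk v v} (hw : w.IsCycle) (x : V) :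
    ∃ u ∈ w.support, u ≠ x := by
  cases w with
  | nil => exact absurd hw (by simp)
  | @cons _ b _ h q =>
    by_cases hx : v = x
    · exact ⟨b, by simp, fun hb => h.ne (hx.trans hb.symm)⟩
    · exact ⟨v, by simp, hx⟩

end Walk

lemma exists_mem_notMem_of_mem_edgeSet_of_subsingleton {W S : Set V} (hS : (S ∩ W).Subsingleton)
    {f : Sym2 V} (hf : f ∈ G.edgeSet) (hfS : ∀ a ∈ f, a ∈ S) : ∃ a ∈ f, a ∉ W := by
  induction f with
  | h a b =>
    by_contra! h
    exact (G.mem_edgeSet.1 hf).ne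
      (hS ⟨hfS a (by simp), h a (by simp)⟩ ⟨hfS b (by simp), h b (by simp)⟩)

end SimpleGraph

open SimpleGraph

lemma mem_bridgeEdges_of_sameBlockContract {G : SimpleGraph V} {v k : V} {w : G.Walk v v}
    {e f : Sym2 V} (he : e ∈ G.edgeSet) (hke : k ∈ e) (hk : k ∉ w.support)
    (hef : SameBlockContract G w e f) : f ∈ G.bridgeEdges {z | z ∈ w.support} k := by
  rcases hef with rfl | ⟨u, c, hc, hec, hfc, hS⟩ | ⟨x, y, p, hp, -, -, -, hW, hep, hfp⟩
  · exact ⟨he, k, hke, mem_reachAvoiding_self hk⟩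
  · have hf := c.edges_subset_edgeSet hfc
    obtain ⟨a, haf, ha⟩ := exists_mem_notMem_of_mem_edgeSet_of_subsingleton hS hf
      (fun a ha => c.mem_support_of_mem_edges hfc ha)
    exact ⟨hf, a, haf, hc.mem_reachAvoiding hS (c.mem_support_of_mem_edges hfc haf) ha
      (c.mem_support_of_mem_edges hec hke) hk⟩
  · have hf := p.edges_subset_edgeSet hfp
    have hkp := p.mem_support_of_mem_edges hep hke
    refine ⟨hf, ?_⟩
    by_cases h : ∃ a ∈ f, a ∉ w.support
    · obtain ⟨a, haf, ha⟩ := h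
      exact ⟨a, haf, hp.mem_reachAvoiding hW (p.mem_support_of_mem_edges hfp haf) ha hkp hk⟩
    · push Not at h
      have hfxy : f = s(x, y) := by
        induction f with
        | h a b =>
          have hab := (G.mem_edgeSet.1 hf).ne
          have ha := hW a (p.mem_support_of_mem_edges hfp (by simp)) (h a (by simp))
          have hb := hW b (p.mem_support_of_mem_edges hfp (by simp)) (h b (by simp))
          grind [Sym2.eq_swap]
      subst hfxy
      rw [hp.edges_eq_of_mem_edges hfp, List.mem_singleton] at hep
      subst hep
      exact absurd (h k hke) hk

lemma eq_of_sameBlockContract_of_subset_support {G : SimpleGraph V} {v : V} {w : G.Walk v v}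
    {e f : Sym2 V} (he : e ∈ G.edgeSet) (hew : ∀ a ∈ e, a ∈ w.support)
    (hef : SameBlockContract G w e f) : f = e := by
  rcases hef with rfl | ⟨u, c, hc, hec, hfc, hS⟩ | ⟨x, y, p, hp, -, -, -, hW, hep, hfp⟩
  · rfl
  · obtain ⟨a, hae, ha⟩ := exists_mem_notMem_of_mem_edgeSet_of_subsingleton hS he
      (fun a ha => c.mem_support_of_mem_edges hec ha)
    exact absurd (hew a hae) ha
  · have hexy : e = s(x, y) := by
      induction e with
      | h a b =>
        have hab := (G.mem_edgeSet.1 he).ne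
        have ha := hW a (p.mem_support_of_mem_edges hep (by simp)) (hew a (by simp))
        have hb := hW b (p.mem_support_of_mem_edges hep (by simp)) (hew b (by simp))
        grind [Sym2.eq_swap]
    subst hexy
    rw [hp.edges_eq_of_mem_edges hep, List.mem_singleton] at hfp
    exact hfp

namespace TwoConnected

variable [Fintype V] {G : SimpleGraph V}

lemma exists_walk_avoiding (hG : TwoConnected G) {x a b : V} (ha : a ≠ x) (hb : b ≠ x) :
    ∃ p : G.Walk a b, x ∉ p.support := by
  obtain ⟨p⟩ := (hG.2.2 x).preconnected ⟨a, ha⟩ ⟨b, hb⟩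
  have h : x ∉ (p.map (SimpleGraph.Embedding.induce _).toHom).support := by
    rw [Walk.support_map, List.mem_map]
    rintro ⟨z, -, hz⟩
    exact z.2 hz
  exact ⟨_, h⟩

lemma exists_adj_ne (hG : TwoConnected G) {x y : V} (hxy : x ≠ y) :
    ∃ z, G.Adj x z ∧ z ≠ y := by
  classical
  obtain ⟨t, ht⟩ : ∃ t, t ∉ ({x, y} : Finset V) := by
    by_contra! h
    have h1 := Finset.card_le_card (fun a _ => h a : (Finset.univ : Finset V) ⊆ {x, y})
    have h2 := Finset.card_le_two (a := x) (b := y)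
    have h3 := hG.1
    rw [Finset.card_univ] at h1
    omega
  simp only [Finset.mem_insert, Finset.mem_singleton, not_or] at ht
  obtain ⟨p, hp⟩ := hG.exists_walk_avoiding hxy ht.2
  cases p with
  | nil => exact absurd rfl ht.1
  | @cons _ z _ h q => exact ⟨z, h, by rintro rfl; exact hp (by simp)⟩

lemma exists_isCycle (hG : TwoConnected G) : ∃ (v : V) (w : G.Walk v v), w.IsCycle := by
  classical
  have : Nontrivial V := Fintype.one_lt_card_iff_nontrivial.1 (by have := hG.1; omega)
  obtain ⟨x, t, hxt⟩ := exists_pair_ne V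
  obtain ⟨y, hxy, -⟩ := hG.exists_adj_ne hxt
  obtain ⟨z, hxz, hzy⟩ := hG.exists_adj_ne hxy.ne
  obtain ⟨p, hp⟩ := hG.exists_walk_avoiding hxy.ne' hxz.ne'
  have hp' : x ∉ p.bypass.support := fun h => hp (p.support_bypass_subset_support h)
  refine ⟨x, .cons hxy (p.bypass.concat hxz.symm), (Walk.cons_isCycle_iff _ _).2 ⟨?_, ?_⟩⟩
  · exact p.bypass_isPath.concat hp' _
  · rw [Walk.edges_concat, List.concat_eq_append, List.mem_append, List.mem_singleton]
    rintro (h | h)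
    · exact hp' (Walk.fst_mem_support_of_mem_edges _ h)
    · rcases Sym2.eq_iff.1 h with ⟨h, -⟩ | ⟨-, h⟩
      exacts [hxz.ne h, hzy h.symm]

/-- A component of the complement of a vertex set with at least two elements has, in a
2-connected graph, an attachment different from any given vertex. -/
lemma exists_attachment_ne (hG : TwoConnected G) {W : Set V} {k : V} (hk : k ∉ W) (x : V)
    (hx : x ∈ W) (hW : ∃ u ∈ W, u ≠ x) :
    ∃ c ∈ W, c ≠ x ∧ ∃ b ∈ G.reachAvoiding W k, G.Adj b c := by
  obtain ⟨u, hu, hux⟩ := hW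
  obtain ⟨p, hp⟩ := hG.exists_walk_avoiding (fun h : k = x => hk (h ▸ hx)) hux
  obtain ⟨d, hd, h1, h2⟩ := p.exists_boundary_dart (G.reachAvoiding W k)
    (mem_reachAvoiding_self hk) (fun h => notMem_of_mem_reachAvoiding h hu)
  refine ⟨d.snd, ?_, ?_, d.fst, h1, d.adj⟩
  · by_contra h
    exact h2 (mem_reachAvoiding_of_adj h1 d.adj h)
  · intro h
    exact hp (h ▸ p.dart_snd_mem_support_of_mem_darts hd)

/-- A cycle can be rerouted through a given component of its complement so that the new cycle
still passes through all attachments of the component and uses an edge joining the component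
to an attachment. -/
lemma exists_isCycle_rerouted (hG : TwoConnected G) {v : V} {w : G.Walk v v} (hw : w.IsCycle)
    {k : V} (hk : k ∉ w.support) :
    ∃ (x : V) (c : G.Walk x x), c.IsCycle ∧
      (∀ a ∈ w.support, ∀ b ∈ G.reachAvoiding {z | z ∈ w.support} k, G.Adj b a →
        a ∈ c.support) ∧
      ∃ b ∈ G.reachAvoiding {z | z ∈ w.support} k, G.Adj x b ∧ b ∈ c.support := by
  classical
  set W : Set V := {z | z ∈ w.support}
  obtain ⟨x, hxW, -, k₁, hk₁, hk₁x⟩ := hG.exists_attachment_ne (W := W) hk v w.start_mem_support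
    (hw.exists_ne_mem_support v)
  obtain ⟨y₀, hy₀W, hy₀x, k₀, hk₀, hk₀y₀⟩ := hG.exists_attachment_ne (W := W) hk x hxW
    (hw.exists_ne_mem_support x)
  obtain ⟨a, p, hp, hpW⟩ : ∃ (a : V) (p : G.Walk a x), p.IsPath ∧ ∀ z, z ∈ p.support ↔ z ∈ W := by
    have hr := hw.rotate hxW
    have hs := fun z => w.mem_support_rotate_iff (w := z) x hxW
    generalize w.rotate x hxW = r at hr hs
    cases r with
    | nil => exact absurd hr (by simp)
    | @cons _ a _ h q =>
      refine ⟨a, q, ((Walk.cons_isCycle_iff q h).1 hr).1, fun z => ?_⟩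
      rw [← show _ ↔ z ∈ W from hs z, Walk.support_cons, List.mem_cons]
      exact ⟨Or.inr, by rintro (rfl | h); exacts [q.end_mem_support, h]⟩
  obtain ⟨y, ⟨hyx, k₂, hk₂, hk₂y⟩, r, hr, hrp, hrA⟩ := hp.exists_suffix_covering
    {z | z ≠ x ∧ ∃ b ∈ G.reachAvoiding W k, G.Adj b z}
    ⟨y₀, (hpW y₀).2 hy₀W, hy₀x, k₀, hk₀, hk₀y₀⟩
  have hrW : ∀ z ∈ r.support, z ∈ W := fun z hz => (hpW z).1 (hrp hz)
  obtain ⟨q, hq⟩ := reachAvoiding_trans (reachAvoiding_symm hk₁) hk₂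
  have hqW : ∀ z ∈ q.bypass.support, z ∉ W := fun z hz =>
    hq z (q.support_bypass_subset_support hz)
  have hk₁W := notMem_of_mem_reachAvoiding hk₁
  refine ⟨x, .cons hk₁x.symm (q.bypass.append (.cons hk₂y r)), ?_, ?_,
    k₁, hk₁, hk₁x.symm, by simp⟩
  · refine (Walk.cons_isCycle_iff _ _).2 ⟨?_, ?_⟩
    · rw [Walk.isPath_def, Walk.support_append, Walk.support_cons, List.tail_cons,
        List.nodup_append]
      refine ⟨q.bypass_isPath.support_nodup, hr.support_nodup, ?_⟩
      rintro a ha _ hb rfl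
      exact hqW a ha (hrW a hb)
    · rw [Walk.edges_append, List.mem_append, Walk.edges_cons, List.mem_cons]
      rintro (h | h | h)
      · exact hqW x (Walk.fst_mem_support_of_mem_edges _ h) hxW
      · rcases Sym2.eq_iff.1 h with ⟨h, -⟩ | ⟨h, -⟩
        · exact notMem_of_mem_reachAvoiding hk₂ (h ▸ hxW)
        · exact hyx h.symm
      · exact hk₁W (hrW _ (Walk.snd_mem_support_of_mem_edges _ h))
  · intro c hc b hb hbc
    by_cases hcx : c = x
    · simp [hcx]
    · have := hrA c ((hpW c).2 hc) ⟨hcx, b, hb, hbc⟩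
      simp [this]

/-- Some cycle of a 2-connected graph has the property that the edges meeting any component of
its complement make up at most half of all edges. -/
lemma exists_isCycle_halving_bridgeEdges (hG : TwoConnected G) :
    ∃ (v : V) (w : G.Walk v v), w.IsCycle ∧ ∀ k ∉ w.support,
      2 * (G.bridgeEdges {z | z ∈ w.support} k).ncard ≤ G.edgeSet.ncard := by
  classical
  have hfin : G.edgeSet.Finite := Set.toFinite _
  have hsub : ∀ (W : Set V) k, G.bridgeEdges W k ⊆ G.edgeSet := fun _ _ _ h => h.1
  let P : ℕ → Prop := fun n => ∃ (v : V) (w : G.Walk v v), w.IsCycle ∧ ∀ k ∉ w.support,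
    2 * (G.bridgeEdges {z | z ∈ w.support} k).ncard ≤ G.edgeSet.ncard ∨
      (G.bridgeEdges {z | z ∈ w.support} k).ncard ≤ n
  have hP : ∃ n, P n := by
    obtain ⟨v, w, hw⟩ := hG.exists_isCycle
    exact ⟨G.edgeSet.ncard, v, w, hw, fun k _ => Or.inr (Set.ncard_le_ncard (hsub _ _) hfin)⟩
  obtain ⟨v, w, hw, hn⟩ := Nat.find_spec hP
  refine ⟨v, w, hw, fun k hk => ?_⟩
  by_contra! hlt
  have hkn := (hn k hk).resolve_left (by omega)
  obtain ⟨x, c, hc, hA, b, hb, hxb, hbc⟩ := hG.exists_isCycle_rerouted hw hk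
  set W : Set V := {z | z ∈ w.support}
  refine Nat.find_min hP (m := (G.bridgeEdges W k).ncard - 1) (by omega)
    ⟨x, c, hc, fun k' hk' => ?_⟩
  have hsep : ∀ a ∈ G.reachAvoiding W k, G.reachAvoiding {z | z ∈ c.support} a ⊆
      G.reachAvoiding W k := fun a ha => reachAvoiding_subset_of_attachments hA ha
  by_cases hkk : k' ∈ G.reachAvoiding W k
  · refine Or.inr (Nat.le_sub_one_of_lt (Set.ncard_lt_ncard ?_ (hfin.subset (hsub _ _))))
    refine (Set.ssubset_iff_of_subset ?_).2 ⟨s(x, b), ⟨hxb, b, by simp, hb⟩, ?_⟩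
    · rintro f ⟨hf, a, haf, ha⟩
      exact ⟨hf, a, haf, hsep k' hkk ha⟩
    · rintro ⟨-, a, ha, ha'⟩
      rcases Sym2.mem_iff.1 ha with rfl | rfl
      exacts [notMem_of_mem_reachAvoiding ha' c.start_mem_support,
        notMem_of_mem_reachAvoiding ha' hbc]
  · have hdisj : Disjoint (G.bridgeEdges {z | z ∈ c.support} k') (G.bridgeEdges W k) := by
      rw [Set.disjoint_left]
      rintro f ⟨hf, a, haf, ha⟩ ⟨-, d, hdf, hd⟩
      have haK : a ∉ G.reachAvoiding W k := fun h => hkk (hsep a h (reachAvoiding_symm ha))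
      have hda : G.Adj d a := by
        have hne : d ≠ a := fun h => haK (h ▸ hd)
        rw [← G.mem_edgeSet, ← (Sym2.mem_and_mem_iff hne).1 ⟨hdf, haf⟩]
        exact hf
      have haW : a ∈ W := by
        by_contra h
        exact haK (mem_reachAvoiding_of_adj hd hda h)
      exact notMem_of_mem_reachAvoiding ha (hA a haW d hd hda)
    have h1 := Set.ncard_union_eq hdisj (hfin.subset (hsub _ _)) (hfin.subset (hsub _ _))
    have h2 := Set.ncard_le_ncard (Set.union_subset (hsub {z | z ∈ c.support} k') (hsub W k)) hfin
    left
    omega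

end TwoConnected

/-- Every 2-connected graph `G` with `m` edges contains a cycle `C`
such that every block of the contracted graph `G/C` has at most `m/2` edges. -/
theorem exists_cycle_halving_blocks [Fintype V] (G : SimpleGraph V) (hG : TwoConnected G)
    (m : ℕ) (hm : m = G.edgeSet.ncard) :
    ∃ (v : V) (w : G.Walk v v), w.IsCycle ∧
      ∀ e ∈ G.edgeSet, e ∉ w.edges →
        2 * {f | f ∈ G.edgeSet ∧ f ∉ w.edges ∧ SameBlockContract G w e f}.ncard ≤ m := by
  obtain ⟨v, w, hw, hk⟩ := hG.exists_isCycle_halving_bridgeEdges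
  have hfin : G.edgeSet.Finite := Set.toFinite _
  refine ⟨v, w, hw, fun e he hew => ?_⟩
  subst hm
  by_cases h : ∃ k ∈ e, k ∉ w.support
  · obtain ⟨k, hke, hkw⟩ := h
    refine le_trans (Nat.mul_le_mul_left 2 (Set.ncard_le_ncard ?_ (hfin.subset ?_))) (hk k hkw)
    · exact fun f hf => mem_bridgeEdges_of_sameBlockContract he hke hkw hf.2.2
    · exact fun f hf => hf.1
  · push Not at h
    obtain ⟨e', he'⟩ : ∃ e', e' ∈ w.edges := by
      cases w with
      | nil => exact absurd hw (by simp)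
      | cons h q => exact ⟨_, List.mem_cons_self⟩
    have h1 : {f | f ∈ G.edgeSet ∧ f ∉ w.edges ∧ SameBlockContract G w e f}.ncard ≤ 1 := by
      rw [← Set.ncard_singleton e]
      exact Set.ncard_le_ncard
        (fun f hf => eq_of_sameBlockContract_of_subset_support he h hf.2.2)
    have h2 : 2 ≤ G.edgeSet.ncard := by
      rw [← Set.ncard_pair (a := e) (b := e') (by rintro rfl; exact hew he')]
      refine Set.ncard_le_ncard ?_ hfin
      rintro f (rfl | rfl)
      exacts [he, w.edges_subset_edgeSet he']
    omega
end
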